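/- arXiv:2208.04801 — 2 statements merged into one kernel-verified Lean document; each statement's English description precedes it below -/
import Mathlib

section
/- The variance of the genus of a uniformly random rooted cubic map with 2n vertices satisfies σ_n² := (1/C_n)·Σ_{g=0}^{n} (g − μ_n)²·C(n,g) ∼ (ln n)/4 as n → ∞, where μ_n := (1/C_n)·Σ_{g=0}^{n} g·C(n,g). -/
open Filter Finset


theorem vg_cesaro (y δ : ℕ → ℝ) (hy : ∀ s, 0 ≤ y s) (hδ : Tendsto δ atTop (nhds 0))
    (N : ℕ) (h : ∀ s, N ≤ s → y (s+1) ≤ y s + δ s) :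
    Tendsto (fun s : ℕ => y s / s) atTop (nhds 0) := by
  have h1 : ∀ s, y (N + s) ≤ y N + ∑ i ∈ range s, |δ (N + i)| := by
    intro s
    induction s with
    | zero => simp
    | succ k ih =>
      rw [sum_range_succ]
      have := h (N + k) (by omega)
      have h2 := le_abs_self (δ (N + k))
      rw [← add_assoc]; linarith
  have h3 : Tendsto (fun s => |δ (N + s)|) atTop (nhds 0) := by
    have := (hδ.comp (tendsto_add_atTop_nat N)).abs
    simp only [abs_zero] at this
    refine this.congr (fun s => ?_)
    simp [add_comm]
  have h4 := h3.cesaro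
  have h5 : Tendsto (fun s : ℕ => y N * (s:ℝ)⁻¹ + (s:ℝ)⁻¹ * ∑ i ∈ range s, |δ (N + i)|) atTop (nhds 0) := by
    simpa using (tendsto_inv_atTop_nhds_zero_nat (𝕜 := ℝ)).const_mul (y N) |>.add h4
  have h6 : Tendsto (fun s : ℕ => y (N + s) / ((N + s : ℕ) : ℝ)) atTop (nhds 0) := by
    refine squeeze_zero' (Eventually.of_forall fun s => div_nonneg (hy _) (Nat.cast_nonneg _)) ?_ h5
    filter_upwards [eventually_gt_atTop 0] with s hs
    have hs' : (0:ℝ) < s := by exact_mod_cast hs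
    calc y (N + s) / ((N + s : ℕ) : ℝ) ≤ y (N + s) / s := by
          apply div_le_div_of_nonneg_left (hy _) hs'
          push_cast; linarith [Nat.cast_nonneg (α := ℝ) N]
      _ ≤ (y N + ∑ i ∈ range s, |δ (N + i)|) / s := by
          gcongr; exact h1 s
      _ = _ := by ring
  rw [← tendsto_add_atTop_iff_nat N]
  refine h6.congr (fun s => by rw [add_comm])

/-- Alternating first-order recursions with slowly contracting factor. -/
theorem vg_alt (x α σ : ℕ → ℝ) (c : ℝ) (hα0 : ∀ s, 0 ≤ α s)
    (hα : Tendsto (fun s : ℕ => (s:ℝ) * (1 - α s)) atTop (nhds 2))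
    (hσ : Tendsto (fun s : ℕ => (s:ℝ) * σ s) atTop (nhds (2 * c)))
    (hx : ∀ s, x (s+1) = - α s * x s + σ s) :
    Tendsto x atTop (nhds 0) := by
  have hinv := tendsto_inv_atTop_nhds_zero_nat (𝕜 := ℝ)
  have hα1 : Tendsto α atTop (nhds 1) := by
    have h := (hα.mul hinv).const_sub 1
    simp only [mul_zero, sub_zero] at h
    refine h.congr' ?_
    filter_upwards [eventually_gt_atTop 0] with s hs
    have hs' : (s:ℝ) ≠ 0 := by exact_mod_cast hs.ne'
    field_simp; ring
  have hss : Tendsto (fun s : ℕ => (s:ℝ) / (s + 1)) atTop (nhds 1) := tendsto_natCast_div_add_atTop 1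
  have hss' : Tendsto (fun s : ℕ => ((s:ℝ) + 1) / s) atTop (nhds 1) := by
    have := hss.inv₀ one_ne_zero
    simpa using this
  set e : ℕ → ℝ := fun s => x s - c / s with he
  set r : ℕ → ℝ := fun s => - c * α s + s * σ s - c * (s / (s+1)) with hr
  have hr0 : Tendsto r atTop (nhds 0) := by
    have := ((hα1.const_mul (-c)).add hσ).sub (hss.const_mul c)
    convert this using 1
    congr 1; ring
  have hev : ∀ᶠ s : ℕ in atTop, 1 ≤ (s:ℝ) * (1 - α s) :=
    hα.eventually (eventually_ge_nhds (by norm_num))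
  obtain ⟨N, hN⟩ := eventually_atTop.1 (hev.and (eventually_gt_atTop 0))
  have hrec : ∀ s, N ≤ s → ((s+1 : ℕ):ℝ) * |e (s+1)| ≤ s * |e s| + ((s:ℝ)+1)/s * |r s| := by
    intro s hs
    obtain ⟨h1, h2⟩ := hN s hs
    have hs' : (0:ℝ) < s := by exact_mod_cast h2
    have h3 : e (s+1) = - α s * e s + r s / s := by
      simp only [he, hr, hx s]; push_cast; field_simp; ring
    have h4 : |e (s+1)| ≤ α s * |e s| + |r s| / s := by
      rw [h3]
      refine (abs_add_le _ _).trans ?_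
      rw [abs_mul, abs_neg, abs_of_nonneg (hα0 s), abs_div, abs_of_pos hs']
    have h5 : ((s:ℝ)+1) * α s ≤ s := by
      have : α s ≤ 1 := by nlinarith
      nlinarith
    push_cast
    calc ((s:ℝ)+1) * |e (s+1)| ≤ ((s:ℝ)+1) * (α s * |e s| + |r s| / s) := by gcongr
      _ = (((s:ℝ)+1) * α s) * |e s| + ((s:ℝ)+1)/s * |r s| := by ring
      _ ≤ _ := by gcongr
  have hlim := vg_cesaro (fun s => s * |e s|) (fun s => ((s:ℝ)+1)/s * |r s|)
    (fun s => by positivity) (by simpa using hss'.mul hr0.abs) N (by simpa using hrec)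
  have he0 : Tendsto e atTop (nhds 0) := by
    rw [tendsto_zero_iff_abs_tendsto_zero]
    refine hlim.congr' ?_
    filter_upwards [eventually_gt_atTop 0] with s hs
    have hs' : (s:ℝ) ≠ 0 := by exact_mod_cast hs.ne'
    simp only [Function.comp]; field_simp
  have := he0.add (hinv.const_mul c)
  simp only [mul_zero, add_zero] at this
  refine this.congr (fun s => ?_)
  simp only [he]; ring

theorem vg_log (S : ℕ → ℝ) (h : Tendsto (fun s : ℕ => (s:ℝ) * (S (s+1) - S s)) atTop (nhds 2)) :
    Tendsto (fun s : ℕ => S s / Real.log s) atTop (nhds 2) := by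
  have hlog : Tendsto (fun s : ℕ => Real.log s) atTop atTop :=
    Real.tendsto_log_atTop.comp tendsto_natCast_atTop_atTop
  have hharm : Tendsto (fun s : ℕ => (harmonic s : ℝ) / Real.log s) atTop (nhds 1) := by
    have := (Real.tendsto_harmonic_sub_log.mul hlog.inv_tendsto_atTop).add_const 1
    simp only [mul_zero, zero_add] at this
    refine this.congr' ?_
    filter_upwards [hlog.eventually_gt_atTop 0] with s hs
    simp only [Pi.inv_apply]
    field_simp; ring
  have hH : ∀ s, (harmonic s : ℝ) = ∑ i ∈ range s, 1 / ((i:ℝ)+1) := by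
    intro s; simp [harmonic]
  have hf : (fun s : ℕ => (S (s+1) - S s) - 2 * (1 / ((s:ℝ)+1))) =o[atTop] (fun s : ℕ => 1 / ((s:ℝ)+1)) := by
    rw [Asymptotics.isLittleO_iff_tendsto (by intro s hs; exfalso; have : (0:ℝ) < 1 / ((s:ℝ)+1) := by positivity
                                              linarith)]
    have hinv := tendsto_inv_atTop_nhds_zero_nat (𝕜 := ℝ)
    have h2 := ((h.mul (hinv.const_add 1))).sub_const 2
    simp only [add_zero, mul_one, sub_self] at h2
    refine h2.congr' ?_
    filter_upwards [eventually_gt_atTop 0] with s hs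
    have hs' : (s:ℝ) ≠ 0 := by exact_mod_cast hs.ne'
    field_simp
  have hinf : Tendsto (fun s => ∑ i ∈ range s, 1 / ((i:ℝ)+1)) atTop atTop :=
    Real.tendsto_sum_range_one_div_nat_succ_atTop
  have h1 := hf.sum_range (fun s => by positivity) hinf
  have h2 := h1.tendsto_div_nhds_zero
  have h3 : Tendsto (fun s : ℕ => (S s - S 0 - 2 * harmonic s) / (harmonic s : ℝ)) atTop (nhds 0) := by
    refine h2.congr (fun s => ?_)
    rw [hH, sum_sub_distrib, sum_range_sub, mul_sum]
  have h4 := ((h3.mul hharm).add (hharm.const_mul 2)).add (hlog.inv_tendsto_atTop.const_mul (S 0))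
  simp only [mul_one, zero_add, mul_zero, add_zero] at h4
  refine h4.congr' ?_
  filter_upwards [hlog.eventually_gt_atTop 0, eventually_gt_atTop 0] with s hs hs0
  have : (harmonic s : ℝ) ≠ 0 := by
    exact_mod_cast (harmonic_pos hs0.ne').ne'
  simp only [Pi.inv_apply]
  field_simp; ring

/-- Growth lemma. -/
theorem vg_growth (x : ℕ → ℝ) (hx0 : ∀ s, 0 ≤ x s) (C : ℝ) (hC : 0 ≤ C)
    (h : ∀ (s : ℕ) (M : ℝ), (∀ k, k ≤ s + 1 → x k ≤ M) →
      x (s+2) ≤ (1 + C / ((s:ℝ)+1)^2) * M + C / ((s:ℝ)+1)) :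
    ∃ K : ℝ, 0 ≤ K ∧ ∀ s k : ℕ, k ≤ s + 2 → x k ≤ K * Real.sqrt (Real.sqrt ((s:ℝ)+1)) := by
  set z : ℕ → ℝ := fun s => Real.sqrt (Real.sqrt ((s:ℝ)+1)) with hz
  have hz4 : ∀ s, z s ^ 4 = (s:ℝ)+1 := by
    intro s
    have : z s ^ 4 = (z s ^ 2)^2 := by ring
    rw [this, hz]; simp only
    rw [Real.sq_sqrt (Real.sqrt_nonneg _), Real.sq_sqrt (by positivity)]
  have hz0 : ∀ s, 0 ≤ z s := fun s => Real.sqrt_nonneg _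
  have hz1 : ∀ s, 1 ≤ z s := by
    intro s
    have h4 := hz4 s
    by_contra hlt
    push Not at hlt
    have : z s ^ 4 < 1 := pow_lt_one₀ (hz0 s) hlt (by norm_num)
    linarith [Nat.cast_nonneg (α := ℝ) s]
  have hzm : ∀ s, z s ≤ z (s+1) := by
    intro s
    simp only [hz]; gcongr; push_cast; linarith
  have hz2 : ∀ s, z (s+1) ≤ 2 * z s := by
    intro s
    refine le_of_pow_le_pow_left₀ (n := 4) (by norm_num) (by linarith [hz0 s]) ?_
    rw [mul_pow, hz4, hz4]; push_cast; linarith [Nat.cast_nonneg (α := ℝ) s]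
  have hinc : ∀ s, 1 / (15 * z s ^ 3) ≤ z (s+1) - z s := by
    intro s
    have e : (z (s+1) - z s) * ((z (s+1) + z s) * (z (s+1)^2 + z s ^2)) = 1 := by
      have := hz4 (s+1); have := hz4 s; push_cast at *; nlinarith
    have hp : 0 < z s := by linarith [hz1 s]
    have hb : (z (s+1) + z s) * (z (s+1)^2 + z s ^2) ≤ 15 * z s ^3 := by
      have h1 : z (s+1) + z s ≤ 3 * z s := by linarith [hz2 s]
      have h2 : z (s+1)^2 + z s^2 ≤ 5 * z s^2 := by
        have := pow_le_pow_left₀ (hz0 (s+1)) (hz2 s) 2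
        nlinarith
      calc _ ≤ (3 * z s) * (5 * z s^2) := by gcongr
        _ = _ := by ring
    rw [div_le_iff₀ (by positivity)]
    have hd : 0 ≤ z (s+1) - z s := by linarith [hzm s]
    rw [← e]; gcongr
  obtain ⟨N, hN⟩ := exists_nat_ge ((30 * C + 1) ^ 4)
  have hzN : ∀ s, N ≤ s → 30 * C ≤ z s := by
    intro s hs
    refine le_of_pow_le_pow_left₀ (n := 4) (by norm_num) (hz0 s) ?_
    rw [hz4]
    have : (N:ℝ) ≤ s := by exact_mod_cast hs
    have h3 : (30 * C)^4 ≤ (30*C+1)^4 := by gcongr; linarith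
    linarith
  set K : ℝ := 1 + ∑ k ∈ range (N + 3), x k with hK
  have hK1 : 1 ≤ K := by
    have : 0 ≤ ∑ k ∈ range (N + 3), x k := sum_nonneg (fun i _ => hx0 i)
    linarith
  have hKN : ∀ k, k < N + 3 → x k ≤ K := by
    intro k hk
    have := single_le_sum (f := x) (fun i _ => hx0 i) (mem_range.2 hk)
    linarith
  refine ⟨K, by linarith, ?_⟩
  intro s
  induction s with
  | zero =>
    intro k hk
    have := hKN k (by omega)
    have := hz1 0
    change x k ≤ K * z 0
    nlinarith
  | succ s ih =>
    intro k hk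
    change x k ≤ K * z (s+1)
    have ih' : ∀ k, k ≤ s + 2 → x k ≤ K * z s := ih
    have hmono : K * z s ≤ K * z (s+1) := by
      have := hzm s; gcongr
    rcases Nat.lt_or_ge k (s+3) with h1 | h1
    · exact (ih' k (by omega)).trans hmono
    · have hk' : k = (s + 1) + 2 := by omega
      rcases Nat.lt_or_ge s N with h2 | h2
      · have := hKN k (by omega)
        have := hz1 (s+1)
        nlinarith
      · subst hk'
        refine (h (s+1) (K * z s) (fun k hk => ih' k (by omega))).trans ?_
        have hp : 0 < z s := by linarith [hz1 s]
        have hs1 : z s ^ 4 ≤ ((s+1:ℕ):ℝ) + 1 := by rw [hz4]; push_cast; linarith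
        have e1 : C / (((s+1:ℕ):ℝ)+1)^2 ≤ C / (z s ^4)^2 := by gcongr
        have e2 : C / (((s+1:ℕ):ℝ)+1) ≤ C / (z s ^4) := by gcongr
        have e3 : C / (z s^4)^2 * z s + C / z s^4 ≤ z (s+1) - z s := by
          refine le_trans ?_ (hinc s)
          have hz30 := hzN s h2
          have : C / (z s^4)^2 * z s ≤ C / z s^4 := by
            rw [div_mul_eq_mul_div, div_le_div_iff₀ (by positivity) (by positivity)]
            have : z s ≤ z s ^ 4 := le_self_pow₀ (hz1 s) (by norm_num)
            nlinarith [mul_le_mul_of_nonneg_left this (show 0 ≤ C * z s^4 by positivity)]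
          have h6 : C / z s^4 + C / z s^4 ≤ 1 / (15 * z s^3) := by
            rw [← two_mul, mul_div_assoc', div_le_div_iff₀ (by positivity) (by positivity)]
            nlinarith [mul_le_mul_of_nonneg_left hz30 (show 0 ≤ z s^3 by positivity)]
          linarith
        have e0 : 0 ≤ C / (z s^4) := by positivity
        calc (1 + C / (((s+1:ℕ):ℝ)+1)^2) * (K * z s) + C / (((s+1:ℕ):ℝ)+1)
            ≤ (1 + C / (z s ^4)^2) * (K * z s) + K * (C / (z s ^4)) := by
              have : C / (z s ^4) ≤ K * (C / (z s ^4)) := by nlinarith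
              have := mul_le_mul_of_nonneg_right e1 (show 0 ≤ K * z s by positivity)
              nlinarith
          _ = K * (z s + (C / (z s^4)^2 * z s + C / z s^4)) := by ring
          _ ≤ K * z (s+1) := by gcongr; linarith


theorem vg_fact2 (a b : ℕ) : (a+2).factorial * (b+2).factorial ≤ 2 * (a+b+2).factorial := by
  induction a with
  | zero => simp [Nat.factorial]
  | succ a ih =>
    have e1 : (a+1+2).factorial = (a+3) * (a+2).factorial := Nat.factorial_succ (a+2)
    have e2 : (a+1+b+2).factorial = (a+b+3) * (a+b+2).factorial := by
      rw [show a+1+b+2 = (a+b+2)+1 by ring, Nat.factorial_succ]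
    rw [e1, e2]
    calc (a+3) * (a+2).factorial * (b+2).factorial = (a+3) * ((a+2).factorial * (b+2).factorial) := by ring
      _ ≤ (a+b+3) * (2 * (a+b+2).factorial) := Nat.mul_le_mul (by omega) ih
      _ = _ := by ring

theorem vg_factsum (s : ℕ) : ∑ i ∈ range s, (i+1).factorial * (s-i).factorial ≤ 4 * s.factorial := by
  match s with
  | 0 => simp
  | 1 => simp
  | r+2 =>
    rw [sum_range_succ, sum_range_succ']
    have h1 : ∑ k ∈ range r, (k+1+1).factorial * (r+2-(k+1)).factorial ≤ ∑ k ∈ range r, 2 * (r+1).factorial := by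
      refine sum_le_sum fun k hk => ?_
      have hk' := mem_range.1 hk
      have := vg_fact2 k (r-1-k)
      rw [show r+2-(k+1) = (r-1-k)+2 by omega]
      rwa [show k + (r-1-k) + 2 = r+1 by omega] at this
    rw [sum_const, card_range, smul_eq_mul] at h1
    have e : (r+2).factorial = (r+2) * (r+1).factorial := Nat.factorial_succ (r+1)
    have e2 : r + 2 - (r+1) = 1 := by omega
    rw [e2]
    simp only [zero_add, Nat.factorial_one, one_mul, mul_one, Nat.sub_zero] at *
    rw [e] 
    nlinarith

noncomputable def vgA (s : ℕ) : ℝ := 4*((s:ℝ)+1)*(3*s+5)*(3*s+1)/(s+2)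
noncomputable def vgB (s : ℕ) : ℝ := 4*(3*(s:ℝ)+5)/(s+2)

theorem vgA_nonneg (s : ℕ) : 0 ≤ vgA s := by unfold vgA; positivity
theorem vgB_nonneg (s : ℕ) : 0 ≤ vgB s := by unfold vgB; positivity
theorem vgB_le (s : ℕ) : vgB s ≤ 12 := by
  unfold vgB; rw [div_le_iff₀ (by positivity)]; linarith

/-- The recursion for the total counts. -/
def VgRec (p : ℕ → ℝ) : Prop :=
  p 0 = 1/2 ∧ p 1 = 2 ∧ ∀ s, p (s+2) = vgA s * p s + vgB s * (p (s+1) + ∑ i ∈ range s, p (i+1) * p (s-i))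

theorem vg_pos {p : ℕ → ℝ} (hp : VgRec p) : ∀ m, 0 < p m := by
  obtain ⟨h0, h1, hr⟩ := hp
  intro m
  induction m using Nat.strong_induction_on with
  | _ m ih =>
    match m with
    | 0 => rw [h0]; norm_num
    | 1 => rw [h1]; norm_num
    | s+2 =>
      rw [hr]
      have e1 := ih s (by omega)
      have e2 := ih (s+1) (by omega)
      have e3 : 0 ≤ ∑ i ∈ range s, p (i+1) * p (s-i) := sum_nonneg fun i hi => by
        have hi' := mem_range.1 hi
        exact (mul_pos (ih (i+1) (by omega)) (ih (s-i) (by omega))).le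
      have : 0 < vgB s := by unfold vgB; positivity
      have := vgA_nonneg s
      positivity

noncomputable def vgT (p : ℕ → ℝ) (m : ℕ) : ℝ := p m / (6^m * m.factorial)

theorem vgT_pos {p : ℕ → ℝ} (hp : VgRec p) (m : ℕ) : 0 < vgT p m := by
  have := vg_pos hp m; unfold vgT; positivity

theorem vg_p_eq (p : ℕ → ℝ) (m : ℕ) : p m = vgT p m * (6^m * m.factorial) := by
  unfold vgT; field_simp

noncomputable def vgE (p : ℕ → ℝ) (s : ℕ) : ℝ := vgB s * (∑ i ∈ range s, p (i+1) * p (s-i)) / (6^(s+2) * (s+2).factorial)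

noncomputable def vgAA (s : ℕ) : ℝ := (3*(s:ℝ)+5)*(3*s+1)/(9*(s+2)^2)
noncomputable def vgBB (s : ℕ) : ℝ := 2*(3*(s:ℝ)+5)/(3*(s+2)^2)

theorem vgAB (s : ℕ) : vgAA s + vgBB s = 1 - 1/(9*((s:ℝ)+2)^2) := by
  unfold vgAA vgBB; field_simp; ring

theorem vgAA_nonneg (s : ℕ) : 0 ≤ vgAA s := by unfold vgAA; positivity
theorem vgBB_nonneg (s : ℕ) : 0 ≤ vgBB s := by unfold vgBB; positivity

theorem vg_fact_cast (s : ℕ) : ((s+2).factorial : ℝ) = ((s:ℝ)+2)*((s:ℝ)+1)*s.factorial := by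
  rw [Nat.factorial_succ, Nat.factorial_succ]; push_cast; ring

theorem vgT_rec {p : ℕ → ℝ} (hp : VgRec p) (s : ℕ) :
    vgT p (s+2) = vgAA s * vgT p s + vgBB s * vgT p (s+1) + vgE p s := by
  have e1 : ((s+1).factorial : ℝ) = ((s:ℝ)+1)*s.factorial := by
    rw [Nat.factorial_succ]; push_cast; ring
  unfold vgT vgE
  rw [hp.2.2 s, vg_fact_cast, e1]
  generalize ∑ i ∈ range s, p (i+1) * p (s-i) = D
  unfold vgA vgB vgAA vgBB
  have : (s.factorial : ℝ) ≠ 0 := by exact_mod_cast s.factorial_ne_zero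
  rw [pow_succ, pow_succ]
  field_simp
  ring

theorem vgE_nonneg {p : ℕ → ℝ} (hp : VgRec p) (s : ℕ) : 0 ≤ vgE p s := by
  have : 0 ≤ ∑ i ∈ range s, p (i+1) * p (s-i) := sum_nonneg fun i _ => 
    (mul_pos (vg_pos hp _) (vg_pos hp _)).le
  have := vgB_nonneg s
  unfold vgE; positivity

theorem vgE_le {p : ℕ → ℝ} (hp : VgRec p) (s : ℕ) (hT : ∀ m ≤ s, vgT p m ≤ 1) :
    vgE p s ≤ 8 / (((s:ℝ)+1)*(s+2)) := by
  have h1 : ∑ i ∈ range s, p (i+1) * p (s-i) ≤ 6^(s+1) * (4 * s.factorial) := by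
    have h2 : ∀ i ∈ range s, p (i+1) * p (s-i) ≤ 6^(s+1) * (((i+1).factorial * (s-i).factorial : ℕ) : ℝ) := by
      intro i hi
      have hi' := mem_range.1 hi
      rw [vg_p_eq p (i+1), vg_p_eq p (s-i)]
      have a1 := hT (i+1) (by omega)
      have a2 := hT (s-i) (by omega)
      have b2 := vgT_pos hp (s-i)
      have e : (6:ℝ)^(s+1) = 6^(i+1) * 6^(s-i) := by rw [← pow_add]; congr 1; omega
      rw [e]; push_cast
      calc _ = (vgT p (i+1) * vgT p (s-i)) * (6^(i+1) * 6^(s-i) * ((i+1).factorial * (s-i).factorial)) := by ring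
        _ ≤ 1 * (6^(i+1) * 6^(s-i) * ((i+1).factorial * (s-i).factorial)) := by
          gcongr; exact mul_le_one₀ a1 b2.le a2
        _ = _ := by ring
    refine (sum_le_sum h2).trans ?_
    rw [← mul_sum, ← Nat.cast_sum]
    gcongr
    exact_mod_cast vg_factsum s
  have hB := vgB_le s
  have hB0 := vgB_nonneg s
  have hf : (0:ℝ) < s.factorial := by exact_mod_cast s.factorial_pos
  have hS : 0 ≤ ∑ i ∈ range s, p (i+1) * p (s-i) := sum_nonneg fun i _ =>
    (mul_pos (vg_pos hp _) (vg_pos hp _)).le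
  unfold vgE
  calc _ ≤ (12:ℝ) * (6^(s+1) * (4 * s.factorial)) / (6^(s+2) * (s+2).factorial) := by gcongr
    _ = _ := by
      rw [vg_fact_cast]; rw [pow_succ 6 (s+1)]; field_simp; norm_num

theorem vgT_base {p : ℕ → ℝ} (hp : VgRec p) : ∀ m, m ≤ 17 → vgT p m ≤ 1/2 := by
  obtain ⟨h0, h1, hr⟩ := hp
  have h2 : p 2 = 25 := by rw [hr 0]; norm_num [vgA, vgB, h0, h1]
  have h3 : p 3 = 480 := by rw [hr 1]; norm_num [vgA, vgB, sum_range_succ, h1, h2]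
  have h4 : p 4 = 12155 := by
    rw [hr 2]; norm_num [vgA, vgB, sum_range_succ, h1, h2, h3]
  have h5 : p 5 = 379680 := by
    rw [hr 3]; norm_num [vgA, vgB, sum_range_succ, h1, h2, h3, h4]
  have h6 : p 6 = 14080250 := by
    rw [hr 4]; norm_num [vgA, vgB, sum_range_succ, h1, h2, h3, h4, h5]
  have h7 : p 7 = 604416000 := by
    rw [hr 5]; norm_num [vgA, vgB, sum_range_succ, h1, h2, h3, h4, h5, h6]
  have h8 : p 8 = 29486725075 := by
    rw [hr 6]; norm_num [vgA, vgB, sum_range_succ, h1, h2, h3, h4, h5, h6, h7]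
  have h9 : p 9 = 1611975206400 := by
    rw [hr 7]; norm_num [vgA, vgB, sum_range_succ, h1, h2, h3, h4, h5, h6, h7, h8]
  have h10 : p 10 = 97641876068750 := by
    rw [hr 8]; norm_num [vgA, vgB, sum_range_succ, h1, h2, h3, h4, h5, h6, h7, h8, h9]
  have h11 : p 11 = 6492903075840000 := by
    rw [hr 9]; norm_num [vgA, vgB, sum_range_succ, h1, h2, h3, h4, h5, h6, h7, h8, h9, h10]
  have h12 : p 12 = 470325819454758750 := by
    rw [hr 10]; norm_num [vgA, vgB, sum_range_succ, h1, h2, h3, h4, h5, h6, h7, h8, h9, h10, h11]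
  have h13 : p 13 = 36868249177534464000 := by
    rw [hr 11]; norm_num [vgA, vgB, sum_range_succ, h1, h2, h3, h4, h5, h6, h7, h8, h9, h10, h11, h12]
  have h14 : p 14 = 3109829520868988212500 := by
    rw [hr 12]; norm_num [vgA, vgB, sum_range_succ, h1, h2, h3, h4, h5, h6, h7, h8, h9, h10, h11, h12, h13]
  have h15 : p 15 = 280873295507745177600000 := by
    rw [hr 13]; norm_num [vgA, vgB, sum_range_succ, h1, h2, h3, h4, h5, h6, h7, h8, h9, h10, h11, h12, h13, h14]
  have h16 : p 16 = 27045687122035757255071875 := by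
    rw [hr 14]; norm_num [vgA, vgB, sum_range_succ, h1, h2, h3, h4, h5, h6, h7, h8, h9, h10, h11, h12, h13, h14, h15]
  have h17 : p 17 = 2765938148032836139008000000 := by
    rw [hr 15]; norm_num [vgA, vgB, sum_range_succ, h1, h2, h3, h4, h5, h6, h7, h8, h9, h10, h11, h12, h13, h14, h15, h16]
  intro m hm
  interval_cases m <;> unfold vgT <;> norm_num [Nat.factorial, h0, h1, h2, h3, h4, h5, h6, h7, h8, h9, h10, h11, h12, h13, h14, h15, h16, h17]

theorem vgT_upper {p : ℕ → ℝ} (hp : VgRec p) : ∀ m, vgT p m ≤ 1 ∧ (16 ≤ m → vgT p m ≤ 1 - 8 / m) := by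
  intro m
  induction m using Nat.strong_induction_on with
  | _ m ih =>
    rcases Nat.lt_or_ge 17 m with h | h
    · obtain ⟨s, rfl⟩ : ∃ s, m = s + 2 := ⟨m - 2, by omega⟩
      have hE := vgE_le hp s (fun k hk => (ih k (by omega)).1)
      have h1 := (ih s (by omega)).2 (by omega)
      have h2 := (ih (s+1) (by omega)).2 (by omega)
      have hs : (0:ℝ) < s := by exact_mod_cast (by omega : 0 < s)
      have hs16 : (16:ℝ) ≤ s := by exact_mod_cast (by omega : 16 ≤ s)
      have h3 : vgT p s ≤ 1 - 8 / ((s:ℝ)+1) := by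
        refine h1.trans ?_
        gcongr; linarith
      push_cast at h2
      have hA := vgAA_nonneg s
      have hB := vgBB_nonneg s
      have hAB : vgAA s + vgBB s ≤ 1 := by
        rw [vgAB]; have : 0 ≤ 1/(9*((s:ℝ)+2)^2) := by positivity
        linarith
      have hq : 0 ≤ 1 - 8 / ((s:ℝ)+1) := by
        rw [sub_nonneg, div_le_one (by positivity)]; linarith
      have key : vgT p (s+2) ≤ 1 - 8 / ((s:ℝ)+2) := by
        rw [vgT_rec hp]
        have e : (8:ℝ) / (((s:ℝ)+1)*(s+2)) = 8 / ((s:ℝ)+1) - 8 / ((s:ℝ)+2) := by field_simp; ring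
        rw [e] at hE
        nlinarith [mul_le_mul_of_nonneg_left h3 hA, mul_le_mul_of_nonneg_left h2 hB,
          mul_le_mul_of_nonneg_right hAB hq]
      push_cast
      refine ⟨key.trans ?_, fun _ => key⟩
      have : 0 ≤ 8 / ((s:ℝ)+2) := by positivity
      linarith
    · have := vgT_base hp m h
      refine ⟨by linarith, fun h16 => ?_⟩
      refine this.trans ?_
      have : (16:ℝ) ≤ m := by exact_mod_cast h16
      have : 8 / (m:ℝ) ≤ 1/2 := by rw [div_le_iff₀ (by linarith)]; linarith
      linarith

theorem vgT_lower {p : ℕ → ℝ} (hp : VgRec p) : ∀ m : ℕ, (1/5) * (1 + 1/((m:ℝ)+1)) ≤ vgT p m := by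
  intro m
  induction m using Nat.strong_induction_on with
  | _ m ih =>
    match m with
    | 0 => unfold vgT; rw [hp.1]; norm_num
    | 1 => unfold vgT; rw [hp.2.1]; norm_num
    | s+2 =>
      have h1 := ih s (by omega)
      have h2 := ih (s+1) (by omega)
      have hE := vgE_nonneg hp s
      have hA := vgAA_nonneg s
      have hB := vgBB_nonneg s
      have hAB := vgAB s
      have hs := Nat.cast_nonneg (α := ℝ) s
      rw [vgT_rec hp]
      push_cast at h2 ⊢
      have h3 : (1/5) * (1 + 1/((s:ℝ)+1+1)) ≤ vgT p s := by
        refine le_trans ?_ h1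
        gcongr; linarith
      have h4 : (1/5) * (1 + 1/((s:ℝ)+2+1)) ≤ (vgAA s + vgBB s) * ((1/5) * (1 + 1/((s:ℝ)+1+1))) := by
        rw [hAB, ← sub_nonneg]
        have : (1 - 1/(9*((s:ℝ)+2)^2)) * ((1/5) * (1 + 1/((s:ℝ)+1+1))) - (1/5) * (1 + 1/((s:ℝ)+2+1))
          = (8 * s^2 + 30*s+27) / (45 * ((s:ℝ)+2)^3*(s+3)) := by
            field_simp; ring
        rw [this]; positivity
      nlinarith [mul_le_mul_of_nonneg_left h3 hA, mul_le_mul_of_nonneg_left h2 hB]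

theorem vg_rat1 : Tendsto (fun s : ℕ => (s:ℝ) * (1 - vgAA s)) atTop (nhds 2) := by
  have hinv := tendsto_inv_atTop_nhds_zero_nat (𝕜 := ℝ)
  have : Tendsto (fun s : ℕ => (18 + 31 * (s:ℝ)⁻¹)/(9*(1+2*(s:ℝ)⁻¹)^2)) atTop (nhds ((18+31*0)/(9*(1+2*0)^2))) := by
    refine Tendsto.div ((hinv.const_mul 31).const_add 18) ((((hinv.const_mul 2).const_add 1).pow 2).const_mul 9) (by norm_num)
  norm_num at this
  refine this.congr' ?_
  filter_upwards [eventually_gt_atTop 0] with s hs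
  have hs' : (s:ℝ) ≠ 0 := by exact_mod_cast hs.ne'
  unfold vgAA
  field_simp; ring

theorem vg_rat2 : Tendsto (fun s : ℕ => (s:ℝ) * vgBB s) atTop (nhds 2) := by
  have hinv := tendsto_inv_atTop_nhds_zero_nat (𝕜 := ℝ)
  have : Tendsto (fun s : ℕ => (2*(3 + 5 * (s:ℝ)⁻¹))/(3*(1+2*(s:ℝ)⁻¹)^2)) atTop (nhds ((2*(3+5*0))/(3*(1+2*0)^2))) := by
    refine Tendsto.div (((hinv.const_mul 5).const_add 3).const_mul 2) ((((hinv.const_mul 2).const_add 1).pow 2).const_mul 3) (by norm_num)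
  norm_num at this
  refine this.congr' ?_
  filter_upwards [eventually_gt_atTop 0] with s hs
  have hs' : (s:ℝ) ≠ 0 := by exact_mod_cast hs.ne'
  unfold vgBB
  field_simp

theorem vgT_diff {p : ℕ → ℝ} (hp : VgRec p) : Tendsto (fun s => vgT p (s+1) - vgT p s) atTop (nhds 0) := by
  refine vg_alt _ vgAA (fun s => vgE p s - 1/(9*((s:ℝ)+2)^2) * vgT p (s+1)) 0 vgAA_nonneg vg_rat1 ?_ ?_
  · have hinv := tendsto_one_div_add_atTop_nhds_zero_nat (𝕜 := ℝ)
    rw [mul_zero]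
    refine squeeze_zero_norm (a := fun s : ℕ => 9 * (1/((s:ℝ)+1))) ?_ (by simpa using hinv.const_mul 9)
    intro s
    have h1 := vgE_le hp s (fun m _ => (vgT_upper hp m).1)
    have h2 := vgE_nonneg hp s
    have h3 := (vgT_upper hp (s+1)).1
    have h4 := vgT_pos hp (s+1)
    have hs := Nat.cast_nonneg (α := ℝ) s
    rw [Real.norm_eq_abs, abs_mul, abs_of_nonneg hs]
    have e1 : vgE p s ≤ 8 * (1/((s:ℝ)+1)^2) := by
      refine h1.trans ?_
      rw [mul_one_div]; gcongr; nlinarith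
    have e2 : 1/(9*((s:ℝ)+2)^2) * vgT p (s+1) ≤ 1/((s:ℝ)+1)^2 := by
      calc _ ≤ 1/(9*((s:ℝ)+2)^2) * 1 := by gcongr
        _ ≤ _ := by rw [mul_one]; apply one_div_le_one_div_of_le (by positivity); nlinarith
    have e3 : 0 ≤ 1/(9*((s:ℝ)+2)^2) * vgT p (s+1) := by positivity
    have e4 : |vgE p s - 1/(9*((s:ℝ)+2)^2) * vgT p (s+1)| ≤ 9 * (1/((s:ℝ)+1)^2) := by
      rw [abs_le]; constructor <;> linarith
    calc _ ≤ ((s:ℝ)+1) * (9 * (1/((s:ℝ)+1)^2)) := by gcongr; linarith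
      _ = _ := by field_simp
  · intro s
    have := vgAB s
    rw [vgT_rec hp]
    linear_combination vgT p (s+1) * this

theorem vgT_ratio {p : ℕ → ℝ} (hp : VgRec p) : Tendsto (fun s => vgT p (s+1) / vgT p (s+2)) atTop (nhds 1) := by
  have h := (vgT_diff hp).comp (tendsto_add_atTop_nat 1)
  have h1 : Tendsto (fun s => vgT p (s+1) / vgT p (s+2) - 1) atTop (nhds 0) := by
    have h5 := (h.abs).const_mul 5
    simp only [abs_zero, mul_zero] at h5
    refine squeeze_zero_norm ?_ h5
    intro s
    have hl : 1/5 ≤ vgT p (s+2) := by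
      refine le_trans ?_ (vgT_lower hp (s+2))
      have : 0 ≤ 1/(((s+2:ℕ):ℝ)+1) := by positivity
      linarith
    have hp0 := vgT_pos hp (s+2)
    have e : vgT p (s+1) / vgT p (s+2) - 1 = -(vgT p (s+2) - vgT p (s+1)) / vgT p (s+2) := by field_simp; ring
    rw [e, Real.norm_eq_abs, abs_div, abs_neg, abs_of_pos hp0, div_le_iff₀ hp0]
    simp only [Function.comp]
    have := abs_nonneg (vgT p (s+2) - vgT p (s+1))
    change _ ≤ 5 * |vgT p (s+2) - vgT p (s+1)| * _
    nlinarith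
  simpa using h1.add_const 1

noncomputable def vgα (p : ℕ → ℝ) (s : ℕ) : ℝ := vgA s * p s / p (s+2)
noncomputable def vgβ (p : ℕ → ℝ) (s : ℕ) : ℝ := vgB s * p (s+1) / p (s+2)
noncomputable def vgw (p : ℕ → ℝ) (s i : ℕ) : ℝ := vgB s * (p (i+1) * p (s-i)) / p (s+2)
noncomputable def vgγ (p : ℕ → ℝ) (s : ℕ) : ℝ := ∑ i ∈ range s, vgw p s i

theorem vg_sum1 {p : ℕ → ℝ} (hp : VgRec p) (s : ℕ) : vgα p s + vgβ p s + vgγ p s = 1 := by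
  have h := vg_pos hp (s+2)
  unfold vgα vgβ vgγ vgw
  rw [← sum_div, ← mul_sum, ← add_div, ← add_div, div_eq_one_iff_eq h.ne', hp.2.2 s]; ring

theorem vgα_nonneg {p : ℕ → ℝ} (hp : VgRec p) (s : ℕ) : 0 ≤ vgα p s := by
  have h := vg_pos hp (s+2); have h1 := vg_pos hp s; have := vgA_nonneg s
  unfold vgα; positivity
theorem vgβ_nonneg {p : ℕ → ℝ} (hp : VgRec p) (s : ℕ) : 0 ≤ vgβ p s := by
  have h := vg_pos hp (s+2); have h1 := vg_pos hp (s+1); have := vgB_nonneg s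
  unfold vgβ; positivity
theorem vgw_nonneg {p : ℕ → ℝ} (hp : VgRec p) (s i : ℕ) : 0 ≤ vgw p s i := by
  have h := vg_pos hp (s+2); have h1 := vg_pos hp (i+1); have h2 := vg_pos hp (s-i); have := vgB_nonneg s
  unfold vgw; positivity
theorem vgγ_nonneg {p : ℕ → ℝ} (hp : VgRec p) (s : ℕ) : 0 ≤ vgγ p s :=
  sum_nonneg fun i _ => vgw_nonneg hp s i

theorem vgγ_le {p : ℕ → ℝ} (hp : VgRec p) (s : ℕ) : vgγ p s ≤ 40 / ((s:ℝ)+1)^2 := by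
  have hl : 1/5 ≤ vgT p (s+2) := by
    refine le_trans ?_ (vgT_lower hp (s+2))
    have : 0 ≤ 1/(((s+2:ℕ):ℝ)+1) := by positivity
    linarith
  have e : vgγ p s = vgE p s / vgT p (s+2) := by
    have := (vg_pos hp (s+2)).ne'
    unfold vgγ vgw vgE vgT
    rw [← sum_div, ← mul_sum]; field_simp
  rw [e, div_le_iff₀ (vgT_pos hp _)]
  refine (vgE_le hp s (fun m _ => (vgT_upper hp m).1)).trans ?_
  calc _ ≤ 8 / ((s:ℝ)+1)^2 := by gcongr; nlinarith [Nat.cast_nonneg (α := ℝ) s]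
    _ = 40 / ((s:ℝ)+1)^2 * (1/5) := by ring
    _ ≤ _ := by gcongr

theorem vgβ_lim {p : ℕ → ℝ} (hp : VgRec p) : Tendsto (fun s : ℕ => (s:ℝ) * vgβ p s) atTop (nhds 2) := by
  have h := vg_rat2.mul (vgT_ratio hp)
  rw [mul_one] at h
  refine h.congr fun s => ?_
  have := (vg_pos hp (s+2)).ne'
  have e1 : ((s+2).factorial : ℝ) = ((s:ℝ)+2)*(s+1).factorial := by
    rw [Nat.factorial_succ]; push_cast; ring
  have hf : ((s+1).factorial : ℝ) ≠ 0 := by exact_mod_cast (s+1).factorial_ne_zero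
  unfold vgβ vgT vgB vgBB
  rw [e1, pow_succ 6 (s+1)]
  field_simp; ring

theorem vgγ_lim {p : ℕ → ℝ} (hp : VgRec p) : Tendsto (fun s : ℕ => (s:ℝ) * vgγ p s) atTop (nhds 0) := by
  have hinv := (tendsto_one_div_add_atTop_nhds_zero_nat (𝕜 := ℝ)).const_mul 40
  rw [mul_zero] at hinv
  refine squeeze_zero (fun s => mul_nonneg (Nat.cast_nonneg _) (vgγ_nonneg hp s)) (fun s => ?_) hinv
  have := vgγ_le hp s
  have h0 := vgγ_nonneg hp s
  calc _ ≤ ((s:ℝ)+1) * (40 / ((s:ℝ)+1)^2) := by gcongr; linarith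
    _ = _ := by field_simp

theorem vgα_lim {p : ℕ → ℝ} (hp : VgRec p) : Tendsto (fun s : ℕ => (s:ℝ) * (1 - vgα p s)) atTop (nhds 2) := by
  have h := (vgβ_lim hp).add (vgγ_lim hp)
  rw [add_zero] at h
  refine h.congr fun s => ?_
  rw [← vg_sum1 hp s]; ring


theorem vg_bdd (f : ℕ → ℝ) (L : ℝ) (h : Tendsto (fun s : ℕ => (s:ℝ) * f s) atTop (nhds L)) :
    ∃ C, 0 ≤ C ∧ ∀ s : ℕ, |f s| ≤ C / ((s:ℝ)+1) := by
  have hinv := tendsto_inv_atTop_nhds_zero_nat (𝕜 := ℝ)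
  have h1 : Tendsto (fun s : ℕ => |((s:ℝ)+1) * f s|) atTop (nhds |L|) := by
    have h2 := (h.add (h.mul hinv)).abs
    simp only [mul_zero, add_zero] at h2
    refine h2.congr' ?_
    filter_upwards [eventually_gt_atTop 0] with s hs
    have hs' : (s:ℝ) ≠ 0 := by exact_mod_cast hs.ne'
    congr 1; field_simp
  obtain ⟨C, hC⟩ := h1.bddAbove_range
  have hC' : ∀ s : ℕ, |((s:ℝ)+1) * f s| ≤ C := fun s => hC ⟨s, rfl⟩
  refine ⟨C, (abs_nonneg _).trans (hC' 0), fun s => ?_⟩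
  have := hC' s
  rw [abs_mul, abs_of_pos (by positivity)] at this
  rw [le_div_iff₀ (by positivity)]; linarith

theorem vg_wsum {p : ℕ → ℝ} (hp : VgRec p) (s : ℕ) (f : ℕ → ℝ) (M : ℝ) (h : ∀ i, i < s → |f i| ≤ M) :
    |∑ i ∈ range s, vgw p s i * f i| ≤ vgγ p s * M := by
  refine (abs_sum_le_sum_abs _ _).trans ?_
  unfold vgγ
  rw [sum_mul]
  refine sum_le_sum fun i hi => ?_
  rw [abs_mul, abs_of_nonneg (vgw_nonneg hp s i)]
  exact mul_le_mul_of_nonneg_left (h i (mem_range.1 hi)) (vgw_nonneg hp s i)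

theorem vg_small {p : ℕ → ℝ} (hp : VgRec p) (F : ℕ → ℝ) (K : ℝ) (hK : 0 ≤ K)
    (h : ∀ s : ℕ, |F s| ≤ vgγ p s * (K * Real.sqrt ((s:ℝ)+1))) :
    Tendsto (fun s : ℕ => (s:ℝ) * F s) atTop (nhds 0) := by
  have h1 : Tendsto (fun s : ℕ => 40 * K * (Real.sqrt ((s:ℝ)+1))⁻¹) atTop (nhds 0) := by
    have : Tendsto (fun s : ℕ => Real.sqrt ((s:ℝ)+1)) atTop atTop :=
      Real.tendsto_sqrt_atTop.comp (tendsto_atTop_add_const_right _ _ tendsto_natCast_atTop_atTop)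
    simpa using this.inv_tendsto_atTop.const_mul (40*K)
  refine squeeze_zero_norm (fun s => ?_) h1
  have hs := Nat.cast_nonneg (α := ℝ) s
  have hq : 0 < Real.sqrt ((s:ℝ)+1) := Real.sqrt_pos.2 (by linarith)
  have hq2 : Real.sqrt ((s:ℝ)+1)^2 = (s:ℝ)+1 := Real.sq_sqrt (by linarith)
  rw [Real.norm_eq_abs, abs_mul, abs_of_nonneg hs]
  calc (s:ℝ) * |F s| ≤ ((s:ℝ)+1) * (40/((s:ℝ)+1)^2 * (K * Real.sqrt ((s:ℝ)+1))) := by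
        have := h s; have := vgγ_le hp s
        gcongr
        · linarith
        · refine (h s).trans ?_; gcongr
    _ = 40 * K * (Real.sqrt ((s:ℝ)+1) / ((s:ℝ)+1)) := by field_simp
    _ = _ := by rw [← hq2]; field_simp; rw [Real.sqrt_sq hq.le]

theorem vg_qle (s : ℕ) : Real.sqrt (Real.sqrt ((s:ℝ)+1)) ≤ Real.sqrt ((s:ℝ)+1) ∧ 
    Real.sqrt (Real.sqrt ((s:ℝ)+1)) ^ 2 = Real.sqrt ((s:ℝ)+1) := by
  have h1 : 1 ≤ Real.sqrt ((s:ℝ)+1) := by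
    rw [Real.one_le_sqrt]; linarith [Nat.cast_nonneg (α := ℝ) s]
  refine ⟨?_, Real.sq_sqrt (by linarith)⟩
  rw [Real.sqrt_le_left (by linarith)]; nlinarith

def VgU (p u : ℕ → ℝ) : Prop := ∀ s, u (s+2) = vgα p s * u s + vgβ p s * (u (s+1) + 1)
    + ∑ i ∈ range s, vgw p s i * (u (i+1) + u (s-i))

def VgV (p u v : ℕ → ℝ) : Prop := ∀ s, v (s+2) = vgα p s * v s + vgβ p s * (v (s+1) + (u (s+1) + 1 - u s)^2)
    + ∑ i ∈ range s, vgw p s i * (v (i+1) + v (s-i) + (u (i+1) + u (s-i) - u s)^2) - (u (s+2) - u s)^2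

/-- Growth bound for a sequence satisfying the mixture recursion up to an `O(1/s)` term. -/
theorem vg_mix_growth {p : ℕ → ℝ} (hp : VgRec p) (x τ : ℕ → ℝ) (C : ℝ) (hC : 0 ≤ C)
    (hτ : ∀ s : ℕ, |τ s| ≤ C / ((s:ℝ)+1))
    (h : ∀ s, x (s+2) = vgα p s * x s + vgβ p s * x (s+1)
      + ∑ i ∈ range s, vgw p s i * (x (i+1) + x (s-i)) + τ s) :
    ∃ K : ℝ, 0 ≤ K ∧ ∀ s k : ℕ, k ≤ s + 2 → |x k| ≤ K * Real.sqrt (Real.sqrt ((s:ℝ)+1)) := by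
  refine vg_growth (fun s => |x s|) (fun s => abs_nonneg _) (40 + C) (by linarith) ?_
  intro s M hM
  have hM0 : 0 ≤ M := (abs_nonneg _).trans (hM 0 (by omega))
  have h1 := vg_wsum hp s (fun i => x (i+1) + x (s-i)) (2*M) (fun i hi => by
    have := hM (i+1) (by omega); have := hM (s-i) (by omega)
    refine (abs_add_le _ _).trans ?_
    linarith)
  have hα := vgα_nonneg hp s
  have hβ := vgβ_nonneg hp s
  have hγ := vgγ_nonneg hp s
  have hγ' := vgγ_le hp s
  have hsum := vg_sum1 hp s
  have h2 : |vgα p s * x s| ≤ vgα p s * M := by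
    rw [abs_mul, abs_of_nonneg hα]; exact mul_le_mul_of_nonneg_left (hM s (by omega)) hα
  have h3 : |vgβ p s * x (s+1)| ≤ vgβ p s * M := by
    rw [abs_mul, abs_of_nonneg hβ]; exact mul_le_mul_of_nonneg_left (hM (s+1) (by omega)) hβ
  have h4 := hτ s
  have h5 : |x (s+2)| ≤ vgα p s * M + vgβ p s * M + vgγ p s * (2*M) + C / ((s:ℝ)+1) := by
    rw [h s]
    refine (abs_add_le _ _).trans (add_le_add ((abs_add_le _ _).trans (add_le_add ((abs_add_le _ _).trans (add_le_add h2 h3)) h1)) h4)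
  refine h5.trans ?_
  have e1 : vgα p s * M + vgβ p s * M + vgγ p s * (2*M) = (1 + vgγ p s) * M := by
    linear_combination M * hsum
  rw [e1]
  have : 40 / ((s:ℝ)+1)^2 ≤ (40+C) / ((s:ℝ)+1)^2 := by gcongr; linarith
  gcongr
  · linarith
  · linarith

theorem vg_main {p u v : ℕ → ℝ} (hp : VgRec p) (hu : VgU p u) (hv : VgV p u v) :
    Tendsto (fun n : ℕ => v (n+1) / Real.log n) atTop (nhds 1) := by
  have hαl := vgα_lim hp
  have hβl := vgβ_lim hp
  have hinv := tendsto_inv_atTop_nhds_zero_nat (𝕜 := ℝ)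
  -- growth of `u`
  obtain ⟨K, hK, hKu⟩ : ∃ K : ℝ, 0 ≤ K ∧ ∀ s k : ℕ, k ≤ s + 2 → |u k| ≤ K * Real.sqrt (Real.sqrt ((s:ℝ)+1)) := by
    obtain ⟨C, hC, hb⟩ := vg_bdd _ _ hβl
    refine vg_mix_growth hp u (vgβ p) C hC hb (fun s => ?_)
    rw [hu s]; ring
  have hKu' : ∀ s k : ℕ, k ≤ s + 2 → |u k| ≤ K * Real.sqrt ((s:ℝ)+1) := fun s k hk =>
    (hKu s k hk).trans (mul_le_mul_of_nonneg_left (vg_qle s).1 hK)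
  -- increments of `u`
  set σ : ℕ → ℝ := fun s => vgβ p s + ∑ i ∈ range s, vgw p s i * (u (i+1) + u (s-i) - u (s+1)) with hσd
  have hx : ∀ s, u (s+2) - u (s+1) = - vgα p s * (u (s+1) - u s) + σ s := by
    intro s
    have h1 := vg_sum1 hp s
    have h2 : ∑ i ∈ range s, vgw p s i * (u (i+1) + u (s-i) - u (s+1))
        = ∑ i ∈ range s, vgw p s i * (u (i+1) + u (s-i)) - vgγ p s * u (s+1) := by
      unfold vgγ; rw [sum_mul, ← sum_sub_distrib]; exact sum_congr rfl fun i _ => by ring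
    simp only [hσd]
    rw [h2, hu s]
    linear_combination u (s+1) * h1
  have hσ : Tendsto (fun s : ℕ => (s:ℝ) * σ s) atTop (nhds 2) := by
    have h1 := vg_small hp (fun s => ∑ i ∈ range s, vgw p s i * (u (i+1) + u (s-i) - u (s+1))) (3*K) (by linarith)
      (fun s => vg_wsum hp s _ _ (fun i hi => by
        have a1 := abs_le.1 (hKu' s (i+1) (by omega))
        have a2 := abs_le.1 (hKu' s (s-i) (by omega))
        have a3 := abs_le.1 (hKu' s (s+1) (by omega))
        rw [abs_le]; constructor <;> linarith))
    have h2 := hβl.add h1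
    rw [add_zero] at h2
    refine h2.congr fun s => ?_
    simp only [hσd]; ring
  have hx0 : Tendsto (fun s => u (s+1) - u s) atTop (nhds 0) :=
    vg_alt _ (vgα p) σ 1 (vgα_nonneg hp) hαl (by simpa using hσ) hx
  have hx2 : Tendsto (fun s => u (s+2) - u s) atTop (nhds 0) := by
    have := (hx0.comp (tendsto_add_atTop_nat 1)).add hx0
    rw [add_zero] at this
    refine this.congr fun s => ?_
    simp only [Function.comp]; ring
  have hsx2 : Tendsto (fun s : ℕ => (s:ℝ) * (u (s+2) - u s)) atTop (nhds 2) := by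
    have := (hαl.mul hx0).add hσ
    rw [mul_zero, zero_add] at this
    refine this.congr fun s => ?_
    linear_combination - (s:ℝ) * hx s
  -- the variance source term
  set τ : ℕ → ℝ := fun s => vgβ p s * (u (s+1) + 1 - u s)^2
    + ∑ i ∈ range s, vgw p s i * (u (i+1) + u (s-i) - u s)^2 - (u (s+2) - u s)^2 with hτd
  have hτ : Tendsto (fun s : ℕ => (s:ℝ) * τ s) atTop (nhds 2) := by
    have h1 := vg_small hp (fun s => ∑ i ∈ range s, vgw p s i * (u (i+1) + u (s-i) - u s)^2) (9*K^2) (by positivity)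
      (fun s => vg_wsum hp s _ _ (fun i hi => by
        have a1 := abs_le.1 (hKu s (i+1) (by omega))
        have a2 := abs_le.1 (hKu s (s-i) (by omega))
        have a3 := abs_le.1 (hKu s s (by omega))
        have a4 : |u (i+1) + u (s-i) - u s| ≤ 3 * (K * Real.sqrt (Real.sqrt ((s:ℝ)+1))) := by
          rw [abs_le]; constructor <;> linarith
        rw [abs_pow]
        calc _ ≤ (3 * (K * Real.sqrt (Real.sqrt ((s:ℝ)+1))))^2 := by gcongr
          _ = 9 * K^2 * (Real.sqrt (Real.sqrt ((s:ℝ)+1)))^2 := by ring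
          _ = _ := by rw [(vg_qle s).2]))
    have h2 := ((hβl.mul ((hx0.add_const 1).pow 2)).add h1).sub (hsx2.mul hx2)
    norm_num at h2
    refine h2.congr fun s => ?_
    simp only [hτd]; ring
  obtain ⟨K', hK', hKv⟩ : ∃ K : ℝ, 0 ≤ K ∧ ∀ s k : ℕ, k ≤ s + 2 → |v k| ≤ K * Real.sqrt (Real.sqrt ((s:ℝ)+1)) := by
    obtain ⟨C, hC, hb⟩ := vg_bdd _ _ hτ
    refine vg_mix_growth hp v τ C hC hb (fun s => ?_)
    rw [hv s]
    simp only [hτd, mul_add, sum_add_distrib]; ring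
  have hKv' : ∀ s k : ℕ, k ≤ s + 2 → |v k| ≤ K' * Real.sqrt ((s:ℝ)+1) := fun s k hk =>
    (hKv s k hk).trans (mul_le_mul_of_nonneg_left (vg_qle s).1 hK')
  set ρ : ℕ → ℝ := fun s => τ s + ∑ i ∈ range s, vgw p s i * (v (i+1) + v (s-i) - v (s+1)) with hρd
  have hd : ∀ s, v (s+2) - v (s+1) = - vgα p s * (v (s+1) - v s) + ρ s := by
    intro s
    have h1 := vg_sum1 hp s
    have h2 : ∑ i ∈ range s, vgw p s i * (v (i+1) + v (s-i) - v (s+1))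
        = ∑ i ∈ range s, vgw p s i * (v (i+1) + v (s-i)) - vgγ p s * v (s+1) := by
      unfold vgγ; rw [sum_mul, ← sum_sub_distrib]; exact sum_congr rfl fun i _ => by ring
    have h3 : ∑ i ∈ range s, vgw p s i * (v (i+1) + v (s-i) + (u (i+1) + u (s-i) - u s)^2)
        = ∑ i ∈ range s, vgw p s i * (v (i+1) + v (s-i)) + ∑ i ∈ range s, vgw p s i * (u (i+1) + u (s-i) - u s)^2 := by
      rw [← sum_add_distrib]; exact sum_congr rfl fun i _ => by ring
    simp only [hρd, hτd]
    rw [h2, hv s, h3]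
    linear_combination v (s+1) * h1
  have hρ : Tendsto (fun s : ℕ => (s:ℝ) * ρ s) atTop (nhds 2) := by
    have h1 := vg_small hp (fun s => ∑ i ∈ range s, vgw p s i * (v (i+1) + v (s-i) - v (s+1))) (3*K') (by linarith)
      (fun s => vg_wsum hp s _ _ (fun i hi => by
        have a1 := abs_le.1 (hKv' s (i+1) (by omega))
        have a2 := abs_le.1 (hKv' s (s-i) (by omega))
        have a3 := abs_le.1 (hKv' s (s+1) (by omega))
        rw [abs_le]; constructor <;> linarith))
    have h2 := hτ.add h1
    rw [add_zero] at h2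
    refine h2.congr fun s => ?_
    simp only [hρd]; ring
  have hd0 : Tendsto (fun s => v (s+1) - v s) atTop (nhds 0) :=
    vg_alt _ (vgα p) ρ 1 (vgα_nonneg hp) hαl (by simpa using hρ) hd
  have hsd2 : Tendsto (fun s : ℕ => (s:ℝ) * ((v (s+1+1) + v (s+1)) - (v (s+1) + v s))) atTop (nhds 2) := by
    have := (hαl.mul hd0).add hρ
    rw [mul_zero, zero_add] at this
    refine this.congr fun s => ?_
    linear_combination - (s:ℝ) * hd s
  have hS := vg_log (fun s => v (s+1) + v s) hsd2
  have hlog : Tendsto (fun s : ℕ => Real.log s) atTop atTop :=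
    Real.tendsto_log_atTop.comp tendsto_natCast_atTop_atTop
  have hfin := (hS.add (hd0.mul hlog.inv_tendsto_atTop)).div_const 2
  norm_num at hfin
  refine hfin.congr fun s => ?_
  simp only [div_eq_mul_inv]; ring


theorem vg_intsum {M : Type*} [AddCommMonoid M] (n : ℕ) (f : ℤ → M) :
    ∑ g ∈ Finset.Icc (0 : ℤ) (n : ℤ), f g = ∑ g ∈ range (n+1), f (g : ℤ) := by
  refine Finset.sum_nbij' (fun g => g.toNat) (fun g => (g : ℤ)) ?_ ?_ ?_ ?_ ?_
  · intro g hg; simp only [mem_Icc, mem_range] at *; omega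
  · intro g hg; simp only [mem_Icc, mem_range] at *; omega
  · intro g hg; simp only [mem_Icc] at *; omega
  · intro g hg; simp
  · intro g hg; simp only [mem_Icc] at hg; congr 1; omega

theorem vg_intsum' {M : Type*} [AddCommMonoid M] (s : ℕ) (f : ℤ → M) :
    ∑ g ∈ Finset.Icc (-1 : ℤ) (s : ℤ), f g = ∑ g ∈ range (s+2), f ((g : ℤ) - 1) := by
  refine Finset.sum_nbij' (fun g => (g+1).toNat) (fun g => (g : ℤ) - 1) ?_ ?_ ?_ ?_ ?_
  · intro g hg; simp only [mem_Icc, mem_range] at *; omega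
  · intro g hg; simp only [mem_Icc, mem_range] at *; omega
  · intro g hg; simp only [mem_Icc] at *; omega
  · intro g hg; simp
  · intro g hg; simp only [mem_Icc] at hg; congr 1; omega

/-- Real-valued, naturally indexed version of the recursion. -/
def VgH (h : ℕ → ℕ → ℝ) : Prop :=
  (∀ g, h 0 g = if g = 0 then 1/2 else 0) ∧ (∀ g, h 1 g = if g = 0 then 2 else 0) ∧
  ∀ s g, h (s+2) g = vgA s * (if g = 0 then 0 else h s (g-1)) +
    vgB s * ∑ k ∈ range (s+2), ∑ i ∈ range (g+1), h k i * h (s+1-k) (g-i)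

theorem vg_supp {h : ℕ → ℕ → ℝ} (hh : VgH h) : ∀ m g, m + 1 < 2 * g → h m g = 0 := by
  obtain ⟨h0, h1, hr⟩ := hh
  intro m
  induction m using Nat.strong_induction_on with
  | _ m ih =>
    intro g hg
    match m with
    | 0 => rw [h0, if_neg (by omega)]
    | 1 => rw [h1, if_neg (by omega)]
    | s+2 =>
      rw [hr, if_neg (by omega), ih s (by omega) (g-1) (by omega), mul_zero, zero_add]
      rw [sum_eq_zero, mul_zero]
      intro k hk
      refine sum_eq_zero fun i hi => ?_
      have hk' := mem_range.1 hk
      have hi' := mem_range.1 hi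
      rcases Nat.lt_or_ge (k+1) (2*i) with hc | hc
      · rw [ih k (by omega) i hc, zero_mul]
      · rw [ih (s+1-k) (by omega) (g-i) (by omega), mul_zero]

noncomputable def vgP (h : ℕ → ℕ → ℝ) (m : ℕ) : Polynomial ℝ :=
  ∑ g ∈ range (m+2), Polynomial.monomial g (h m g)

theorem vgP_coeff {h : ℕ → ℕ → ℝ} (hh : VgH h) (m g : ℕ) : (vgP h m).coeff g = h m g := by
  unfold vgP
  simp only [Polynomial.finsetSum_coeff, Polynomial.coeff_monomial, sum_ite_eq', mem_range]
  split_ifs with hg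
  · rfl
  · exact (vg_supp hh m g (by omega)).symm

theorem vgP_eq {h : ℕ → ℕ → ℝ} (hh : VgH h) (m N : ℕ) (hN : m + 1 < 2 * N) :
    vgP h m = ∑ g ∈ range N, Polynomial.monomial g (h m g) := by
  ext g
  rw [vgP_coeff hh]
  simp only [Polynomial.finsetSum_coeff, Polynomial.coeff_monomial, sum_ite_eq', mem_range]
  split_ifs with hg
  · rfl
  · exact (vg_supp hh m g (by omega))

theorem vgP_rec {h : ℕ → ℕ → ℝ} (hh : VgH h) (s : ℕ) :
    vgP h (s+2) = Polynomial.C (vgA s) * (Polynomial.X * vgP h s)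
      + Polynomial.C (vgB s) * ∑ k ∈ range (s+2), vgP h k * vgP h (s+1-k) := by
  ext g
  rw [vgP_coeff hh, hh.2.2 s g, Polynomial.coeff_add, Polynomial.coeff_C_mul, Polynomial.coeff_C_mul,
    Polynomial.finsetSum_coeff]
  congr 2
  · cases g with
    | zero => simp
    | succ g => simp [Polynomial.coeff_X_mul, vgP_coeff hh]
  · refine sum_congr rfl fun k _ => ?_
    rw [Polynomial.coeff_mul, Finset.Nat.sum_antidiagonal_eq_sum_range_succ
      (fun i j => (vgP h k).coeff i * (vgP h (s+1-k)).coeff j)]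
    exact sum_congr rfl fun i _ => by rw [vgP_coeff hh, vgP_coeff hh]

noncomputable def vgp (h : ℕ → ℕ → ℝ) (m : ℕ) : ℝ := (vgP h m).eval 1
noncomputable def vgd (h : ℕ → ℕ → ℝ) (m : ℕ) : ℝ := (Polynomial.derivative (vgP h m)).eval 1
noncomputable def vgdd (h : ℕ → ℕ → ℝ) (m : ℕ) : ℝ :=
  (Polynomial.derivative (Polynomial.derivative (vgP h m))).eval 1
noncomputable def vgQ (h : ℕ → ℕ → ℝ) (m : ℕ) : ℝ := ((m:ℝ)+1) * vgp h m - 2 * vgd h m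
noncomputable def vgS (h : ℕ → ℕ → ℝ) (m : ℕ) : ℝ :=
  ((m:ℝ)+1)^2 * vgp h m - 4 * ((m:ℝ)+1) * vgd h m + 4 * (vgdd h m + vgd h m)

theorem vgp_rec {h : ℕ → ℕ → ℝ} (hh : VgH h) (s : ℕ) :
    vgp h (s+2) = vgA s * vgp h s + vgB s * ∑ k ∈ range (s+2), vgp h k * vgp h (s+1-k) := by
  unfold vgp
  rw [vgP_rec hh]
  simp [Polynomial.eval_finsetSum]

theorem vgd_rec {h : ℕ → ℕ → ℝ} (hh : VgH h) (s : ℕ) :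
    vgd h (s+2) = vgA s * (vgp h s + vgd h s) + vgB s * ∑ k ∈ range (s+2),
      (vgd h k * vgp h (s+1-k) + vgp h k * vgd h (s+1-k)) := by
  unfold vgp vgd
  rw [vgP_rec hh]
  simp [Polynomial.eval_finsetSum, Polynomial.derivative_sum, Polynomial.derivative_mul]

theorem vgdd_rec {h : ℕ → ℕ → ℝ} (hh : VgH h) (s : ℕ) :
    vgdd h (s+2) = vgA s * (2 * vgd h s + vgdd h s) + vgB s * ∑ k ∈ range (s+2),
      (vgdd h k * vgp h (s+1-k) + 2 * (vgd h k * vgd h (s+1-k)) + vgp h k * vgdd h (s+1-k)) := by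
  unfold vgp vgd vgdd
  rw [vgP_rec hh]
  simp only [Polynomial.derivative_add, Polynomial.derivative_mul, Polynomial.derivative_C, zero_mul, zero_add,
    Polynomial.derivative_X, one_mul, Polynomial.derivative_sum, Polynomial.eval_add, Polynomial.eval_mul,
    Polynomial.eval_C, Polynomial.eval_X, Polynomial.eval_finsetSum]
  congr 1
  · ring
  · congr 1; exact sum_congr rfl fun k _ => by ring

theorem vgQ_rec {h : ℕ → ℕ → ℝ} (hh : VgH h) (s : ℕ) :
    vgQ h (s+2) = vgA s * vgQ h s + vgB s * ∑ k ∈ range (s+2),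
      (vgQ h k * vgp h (s+1-k) + vgp h k * vgQ h (s+1-k)) := by
  have e : ∑ k ∈ range (s+2), (vgQ h k * vgp h (s+1-k) + vgp h k * vgQ h (s+1-k))
      = ((s:ℝ)+3) * ∑ k ∈ range (s+2), vgp h k * vgp h (s+1-k)
       - 2 * ∑ k ∈ range (s+2), (vgd h k * vgp h (s+1-k) + vgp h k * vgd h (s+1-k)) := by
    rw [mul_sum, mul_sum, ← sum_sub_distrib]
    refine sum_congr rfl fun k hk => ?_
    have hk' := mem_range.1 hk
    have hc : ((s+1-k : ℕ) : ℝ) = (s:ℝ)+1-k := by rw [Nat.cast_sub (by omega)]; push_cast; ring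
    unfold vgQ; rw [hc]; ring
  rw [e]
  unfold vgQ
  rw [vgp_rec hh, vgd_rec hh]; push_cast; ring

theorem vgS_rec {h : ℕ → ℕ → ℝ} (hh : VgH h) (s : ℕ) :
    vgS h (s+2) = vgA s * vgS h s + vgB s * ∑ k ∈ range (s+2),
      (vgS h k * vgp h (s+1-k) + 2 * (vgQ h k * vgQ h (s+1-k)) + vgp h k * vgS h (s+1-k)) := by
  have e : ∑ k ∈ range (s+2),
      (vgS h k * vgp h (s+1-k) + 2 * (vgQ h k * vgQ h (s+1-k)) + vgp h k * vgS h (s+1-k))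
      = ((s:ℝ)+3)^2 * ∑ k ∈ range (s+2), vgp h k * vgp h (s+1-k)
       - (4 * ((s:ℝ)+3) - 4) * ∑ k ∈ range (s+2), (vgd h k * vgp h (s+1-k) + vgp h k * vgd h (s+1-k))
       + 4 * ∑ k ∈ range (s+2),
      (vgdd h k * vgp h (s+1-k) + 2 * (vgd h k * vgd h (s+1-k)) + vgp h k * vgdd h (s+1-k)) := by
    rw [mul_sum, mul_sum, mul_sum, ← sum_sub_distrib, ← sum_add_distrib]
    refine sum_congr rfl fun k hk => ?_
    have hk' := mem_range.1 hk
    have hc : ((s+1-k : ℕ) : ℝ) = (s:ℝ)+1-k := by rw [Nat.cast_sub (by omega)]; push_cast; ring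
    unfold vgQ vgS; rw [hc]; ring
  rw [e]
  unfold vgS
  rw [vgp_rec hh, vgd_rec hh, vgdd_rec hh]; push_cast; ring

theorem vg_split (s : ℕ) (f : ℕ → ℕ → ℝ) : ∑ k ∈ range (s+2), f k (s+1-k)
    = f 0 (s+1) + f (s+1) 0 + ∑ i ∈ range s, f (i+1) (s-i) := by
  rw [sum_range_succ, sum_range_succ']
  simp only [Nat.add_sub_add_right, Nat.sub_self, Nat.sub_zero]; ring

theorem vg_init {h : ℕ → ℕ → ℝ} (hh : VgH h) :
    vgp h 0 = 1/2 ∧ vgp h 1 = 2 ∧ vgQ h 0 = 1/2 ∧ vgS h 0 = 1/2 := by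
  have h0 : vgP h 0 = Polynomial.C (1/2) := by
    ext g; rw [vgP_coeff hh, hh.1, Polynomial.coeff_C]
  have h1 : vgP h 1 = Polynomial.C 2 := by
    ext g; rw [vgP_coeff hh, hh.2.1, Polynomial.coeff_C]
  have a : vgp h 0 = 1/2 := by unfold vgp; rw [h0]; simp
  have b : vgd h 0 = 0 := by unfold vgd; rw [h0]; simp
  have c : vgdd h 0 = 0 := by unfold vgdd; rw [h0]; simp
  refine ⟨a, ?_, ?_, ?_⟩
  · unfold vgp; rw [h1]; simp
  · unfold vgQ; rw [a, b]; norm_num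
  · unfold vgS; rw [a, b, c]; norm_num

theorem vg_isRec {h : ℕ → ℕ → ℝ} (hh : VgH h) : VgRec (vgp h) := by
  obtain ⟨a, b, -, -⟩ := vg_init hh
  refine ⟨a, b, fun s => ?_⟩
  rw [vgp_rec hh, vg_split s (fun x y => vgp h x * vgp h y), a]; ring

noncomputable def vgu (h : ℕ → ℕ → ℝ) (m : ℕ) : ℝ := vgQ h m / vgp h m
noncomputable def vgv (h : ℕ → ℕ → ℝ) (m : ℕ) : ℝ := vgS h m / vgp h m - vgu h m ^ 2

theorem vg_isU {h : ℕ → ℕ → ℝ} (hh : VgH h) : VgU (vgp h) (vgu h) := by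
  obtain ⟨a, b, c, d⟩ := vg_init hh
  have hpos := vg_pos (vg_isRec hh)
  intro s
  have hw : ∀ i, vgw (vgp h) s i * (vgu h (i+1) + vgu h (s-i)) =
      vgB s * (vgQ h (i+1) * vgp h (s-i) + vgp h (i+1) * vgQ h (s-i)) / vgp h (s+2) := by
    intro i
    have h1 := (hpos (s+2)).ne'; have h2 := (hpos (i+1)).ne'; have h3 := (hpos (s-i)).ne'
    unfold vgw vgu; field_simp
  simp only [hw]
  rw [← sum_div, ← mul_sum]
  have hq := vgQ_rec hh s
  rw [vg_split s (fun x y => vgQ h x * vgp h y + vgp h x * vgQ h y), a, c] at hq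
  have h1 := (hpos (s+2)).ne'; have h2 := (hpos (s+1)).ne'; have h3 := (hpos s).ne'
  have e : vgu h (s+2) = vgQ h (s+2) / vgp h (s+2) := rfl
  rw [e, hq]
  unfold vgα vgβ vgu
  field_simp; ring

theorem vg_isV {h : ℕ → ℕ → ℝ} (hh : VgH h) : VgV (vgp h) (vgu h) (vgv h) := by
  obtain ⟨a, b, c, d⟩ := vg_init hh
  have hpos := vg_pos (vg_isRec hh)
  have hS : ∀ m, vgS h m = vgp h m * (vgv h m + vgu h m ^ 2) := by
    intro m
    have := (hpos m).ne'
    unfold vgv; field_simp; ring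
  have hQ : ∀ m, vgQ h m = vgp h m * vgu h m := by
    intro m
    have := (hpos m).ne'
    unfold vgu; field_simp
  intro s
  have hs := vgS_rec hh s
  rw [vg_split s (fun x y => vgS h x * vgp h y + 2 * (vgQ h x * vgQ h y) + vgp h x * vgS h y), a, c, d] at hs
  have h1 := (hpos (s+2)).ne'
  have hs' : vgv h (s+2) + vgu h (s+2)^2 = vgα (vgp h) s * (vgv h s + vgu h s^2)
      + vgβ (vgp h) s * (vgv h (s+1) + vgu h (s+1)^2 + 2 * vgu h (s+1) + 1)
      + ∑ i ∈ range s, vgw (vgp h) s i * (vgv h (i+1) + vgv h (s-i) + (vgu h (i+1) + vgu h (s-i))^2) := by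
    have hw : ∀ i, vgw (vgp h) s i * (vgv h (i+1) + vgv h (s-i) + (vgu h (i+1) + vgu h (s-i))^2) =
      vgB s * (vgS h (i+1) * vgp h (s-i) + 2 * (vgQ h (i+1) * vgQ h (s-i)) + vgp h (i+1) * vgS h (s-i)) / vgp h (s+2) := by
      intro i
      simp only [hS, hQ]; unfold vgw; ring
    simp only [hw]
    rw [← sum_div, ← mul_sum]
    have e : vgv h (s+2) + vgu h (s+2)^2 = vgS h (s+2) / vgp h (s+2) := by unfold vgv; ring
    rw [e, hs]
    generalize ∑ i ∈ range s, (vgS h (i+1) * vgp h (s-i) + 2 * (vgQ h (i+1) * vgQ h (s-i)) + vgp h (i+1) * vgS h (s-i)) = D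
    simp only [hS s, hS (s+1), hQ (s+1)]
    unfold vgα vgβ
    field_simp; ring
  have hu := vg_isU hh s
  have h2 : ∑ i ∈ range s, vgw (vgp h) s i * (vgv h (i+1) + vgv h (s-i) + (vgu h (i+1) + vgu h (s-i) - vgu h s)^2)
    = ∑ i ∈ range s, vgw (vgp h) s i * (vgv h (i+1) + vgv h (s-i) + (vgu h (i+1) + vgu h (s-i))^2)
      - 2 * vgu h s * ∑ i ∈ range s, vgw (vgp h) s i * (vgu h (i+1) + vgu h (s-i))
      + vgu h s^2 * vgγ (vgp h) s := by
    unfold vgγ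
    rw [mul_sum, mul_sum, ← sum_sub_distrib, ← sum_add_distrib]
    exact sum_congr rfl fun i _ => by ring
  rw [h2]
  have h3 := vg_sum1 (vg_isRec hh) s
  linear_combination hs' - 2 * vgu h s * hu - vgu h s^2 * h3

theorem vg_isH (H : ℤ → ℤ → ℚ)
    (hH1 : ∀ g : ℤ, H (-1) g = if g = 0 then 1/2 else 0)
    (hH2 : ∀ g : ℤ, H 0 g = if g = 0 then 2 else 0)
    (hH3 : ∀ n g : ℤ, g < 0 → H n g = 0)
    (hHrec : ∀ n g : ℤ, 1 ≤ n → 0 ≤ g →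
      H n g = (4*n*(3*n+2)*(3*n-2)/(n+1)) * H (n-2) (g-1)
        + (4*(3*n+2)/(n+1)) *
          ∑ k ∈ Finset.Icc (-1 : ℤ) (n-1), ∑ i ∈ Finset.Icc (0 : ℤ) g,
            H k i * H (n-2-k) (g-i)) :
    VgH (fun m g => ((H ((m:ℤ)-1) (g:ℤ) : ℚ) : ℝ)) := by
  refine ⟨fun g => ?_, fun g => ?_, fun s g => ?_⟩
  · have := hH1 g
    simp only [Nat.cast_zero, zero_sub, this]
    by_cases hg : g = 0 <;> simp [hg]
  · have := hH2 g
    simp only [Nat.cast_one, sub_self, this]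
    by_cases hg : g = 0 <;> simp [hg]
  · have h1 := hHrec ((s:ℤ)+1) g (by omega) (by omega)
    rw [show (s:ℤ)+1-1 = (s:ℤ) by ring, vg_intsum'] at h1
    simp only [vg_intsum] at h1
    simp only
    rw [show (((s+2:ℕ):ℤ)-1) = (s:ℤ)+1 by push_cast; ring, h1]
    push_cast
    congr 1
    · congr 1
      · unfold vgA; congr 1 <;> ring
      · rw [show (s:ℤ)+1-2 = (s:ℤ)-1 by ring]
        split_ifs with hg
        · subst hg; rw [hH3 _ _ (by norm_num)]; simp
        · rw [Nat.cast_sub (by omega)]; simp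
    · congr 1
      · unfold vgB; congr 1 <;> ring
      · refine sum_congr rfl fun k hk => sum_congr rfl fun i hi => ?_
        have hk' := mem_range.1 hk
        have hi' := mem_range.1 hi
        rw [Nat.cast_sub (by omega : k ≤ s+1), Nat.cast_sub (by omega : i ≤ g)]
        push_cast
        rw [show (s:ℤ)+1-2-((k:ℤ)-1) = (s:ℤ)+1-k-1 by ring]

/-- The variance of the genus of a uniformly random rooted cubic map with `2n`
vertices is asymptotic to `(ln n)/4`. -/
theorem variance_genus_asymptotic
    (H : ℤ → ℤ → ℚ)
    (hH1 : ∀ g : ℤ, H (-1) g = if g = 0 then 1/2 else 0)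
    (hH2 : ∀ g : ℤ, H 0 g = if g = 0 then 2 else 0)
    (hH3 : ∀ n g : ℤ, g < 0 → H n g = 0)
    (hHrec : ∀ n g : ℤ, 1 ≤ n → 0 ≤ g →
      H n g = (4*n*(3*n+2)*(3*n-2)/(n+1)) * H (n-2) (g-1)
        + (4*(3*n+2)/(n+1)) *
          ∑ k ∈ Finset.Icc (-1 : ℤ) (n-1), ∑ i ∈ Finset.Icc (0 : ℤ) g,
            H k i * H (n-2-k) (g-i)) :
    Tendsto
      (fun n : ℕ =>
        (((∑ g ∈ Finset.Icc (0 : ℤ) (n : ℤ),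
              ((g : ℚ) -
                  (∑ g' ∈ Finset.Icc (0 : ℤ) (n : ℤ),
                      (g' : ℚ) * (H (n : ℤ) g' / (3 * (n : ℚ) + 2))) /
                    (∑ g' ∈ Finset.Icc (0 : ℤ) (n : ℤ),
                      H (n : ℤ) g' / (3 * (n : ℚ) + 2))) ^ 2 *
                (H (n : ℤ) g / (3 * (n : ℚ) + 2))) /
            (∑ g ∈ Finset.Icc (0 : ℤ) (n : ℤ),
              H (n : ℤ) g / (3 * (n : ℚ) + 2)) : ℚ) : ℝ) /
          (Real.log n / 4))
      atTop (nhds 1) := by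
  have hh := vg_isH H hH1 hH2 hH3 hHrec
  set h : ℕ → ℕ → ℝ := fun m g => ((H ((m:ℤ)-1) (g:ℤ) : ℚ) : ℝ) with hdef
  have hmain := vg_main (vg_isRec hh) (vg_isU hh) (vg_isV hh)
  refine hmain.congr' ?_
  filter_upwards [eventually_ge_atTop 2] with n hn
  have hpos := vg_pos (vg_isRec hh) (n+1)
  have hH : ∀ g : ℕ, ((H (n:ℤ) (g:ℤ) : ℚ) : ℝ) = h (n+1) g := by
    intro g; simp only [hdef]; congr 2; push_cast; ring
  have hP := vgP_eq hh (n+1) (n+1) (by omega)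
  have hp : vgp h (n+1) = ∑ g ∈ range (n+1), h (n+1) g := by
    unfold vgp; rw [hP]; simp [Polynomial.eval_finsetSum]
  have hd : vgd h (n+1) = ∑ g ∈ range (n+1), (g:ℝ) * h (n+1) g := by
    unfold vgd; rw [hP]; simp [Polynomial.eval_finsetSum, Polynomial.derivative_sum, Polynomial.derivative_monomial, mul_comm]
  have hdd : vgdd h (n+1) + vgd h (n+1) = ∑ g ∈ range (n+1), (g:ℝ)^2 * h (n+1) g := by
    rw [hd]
    unfold vgdd; rw [hP]
    simp only [Polynomial.eval_finsetSum, Polynomial.derivative_sum, Polynomial.derivative_monomial,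
      Polynomial.eval_monomial, one_pow, mul_one]
    rw [← sum_add_distrib]
    refine sum_congr rfl fun g _ => ?_
    cases g with
    | zero => simp
    | succ g => simp only [Nat.add_sub_cancel]; push_cast; ring
  simp only [vg_intsum]
  push_cast
  simp only [hH]
  have hc : (0:ℝ) < 3 * n + 2 := by positivity
  set c : ℝ := 3 * n + 2 with hcd
  have e0 : ∑ g ∈ range (n+1), h (n+1) g / c = vgp h (n+1) / c := by rw [hp, sum_div]
  have e1 : ∑ g ∈ range (n+1), (g:ℝ) * (h (n+1) g / c) = vgd h (n+1) / c := by
    rw [hd, sum_div]; exact sum_congr rfl fun g _ => by ring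
  rw [e0, e1]
  set μ : ℝ := vgd h (n+1) / c / (vgp h (n+1) / c) with hμ
  have hμ' : μ = vgd h (n+1) / vgp h (n+1) := by rw [hμ]; field_simp
  have e2 : ∑ g ∈ range (n+1), ((g:ℝ) - μ)^2 * (h (n+1) g / c)
      = ((vgdd h (n+1) + vgd h (n+1)) - 2 * μ * vgd h (n+1) + μ^2 * vgp h (n+1)) / c := by
    rw [hdd, hd, hp, mul_sum, mul_sum, ← sum_sub_distrib, ← sum_add_distrib, sum_div]
    exact sum_congr rfl fun g _ => by ring
  rw [e2, hμ']
  unfold vgv vgu vgS vgQ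
  generalize vgdd h (n+1) = x at *
  generalize vgd h (n+1) = y at *
  generalize vgp h (n+1) = z at *
  generalize Real.log n = l
  have hz := hpos.ne'
  rcases eq_or_ne l 0 with hl | hl
  · simp [hl]
  · field_simp; ring
end

section
/- The region (face-count) distribution of cubic graphs is asymptotically normal with mean and variance both asymptotic to ln n: for every real number t, (1/C_n)·Σ_{g : 0 ≤ g ≤ n, n+2−2g ≤ ln n + t·√(ln n)} C(n,g) → Φ(t) as n → ∞, where Φ(t) = (1/√(2π)) ∫_{-∞}^{t} e^{-x²/2} dx; moreover (1/C_n)·Σ_{g=0}^{n} (n+2−2g)·C(n,g) ∼ ln n. -/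
open Filter Finset MeasureTheory

namespace CubicMaps

/-- Coefficient of `h n` in the recurrence for `h (n+2)`. -/
noncomputable def cA (n : ℕ) : ℝ := 4 * ((n : ℝ) + 2) * (3 * n + 8) * (3 * n + 4) / (n + 3)

/-- Coefficient of the quadratic part in the recurrence for `h (n+2)`. -/
noncomputable def cB (n : ℕ) : ℝ := 4 * (3 * (n : ℝ) + 8) / (n + 3)

/-- The recurrence satisfied by the row totals. -/
structure IsTotal (h : ℕ → ℝ) : Prop where
  zero : h 0 = 2
  one : h 1 = 25
  step : ∀ n, h (n + 2) = cA n * h n + cB n * (h (n + 1) + ∑ p ∈ antidiagonal n, h p.1 * h p.2)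

lemma cA_pos (n : ℕ) : 0 < cA n := by unfold cA; positivity
lemma cB_pos (n : ℕ) : 0 < cB n := by unfold cB; positivity

/-- Two-step induction. -/
lemma two_step {p : ℕ → Prop} (h0 : p 0) (h1 : p 1)
    (hs : ∀ n, (∀ k ≤ n + 1, p k) → p (n + 2)) (n : ℕ) : p n := by
  induction n using Nat.strong_induction_on with
  | _ n ih =>
    match n, ih with
    | 0, _ => exact h0
    | 1, _ => exact h1
    | n + 2, ih => exact hs n fun k hk => ih k (by omega)

variable {h : ℕ → ℝ}

lemma IsTotal.pos (H : IsTotal h) (n : ℕ) : 0 < h n := by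
  induction n using two_step with
  | h0 => rw [H.zero]; norm_num
  | h1 => rw [H.one]; norm_num
  | hs n ih =>
    rw [H.step]
    have h2 : 0 ≤ ∑ p ∈ antidiagonal n, h p.1 * h p.2 := by
      apply sum_nonneg
      intro p hp
      have := mem_antidiagonal.1 hp
      exact (mul_pos (ih _ (by omega)) (ih _ (by omega))).le
    have := mul_pos (cA_pos n) (ih n (by omega))
    have := mul_pos (cB_pos n) (add_pos_of_pos_of_nonneg (ih (n+1) le_rfl) h2)
    linarith

lemma fact_aux2 (k l : ℕ) : (k + 2).factorial * (l + 2).factorial ≤ 2 * (k + l + 2).factorial := by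
  induction k with
  | zero => simp [Nat.factorial]
  | succ k ih =>
    rw [show k + 1 + 2 = (k + 2) + 1 by ring, Nat.factorial_succ,
      show k + 1 + l + 2 = (k + l + 2) + 1 by ring, Nat.factorial_succ (k + l + 2)]
    nlinarith [Nat.mul_le_mul (show k + 2 + 1 ≤ k + l + 2 + 1 by omega) ih]

lemma fact_aux4 (k l : ℕ) :
    (k + 4).factorial * (l + 4).factorial ≤ 24 * (k + l + 4).factorial := by
  induction k with
  | zero => simp [Nat.factorial]
  | succ k ih =>
    rw [show k + 1 + 4 = (k + 4) + 1 by ring, Nat.factorial_succ,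
      show k + 1 + l + 4 = (k + l + 4) + 1 by ring, Nat.factorial_succ (k + l + 4)]
    nlinarith [Nat.mul_le_mul (show k + 4 + 1 ≤ k + l + 4 + 1 by omega) ih]

lemma IsTotal.crude (H : IsTotal h) (n : ℕ) : h n ≤ 6 ^ n * ((n + 2).factorial : ℝ) := by
  induction n using two_step with
  | h0 => rw [H.zero]; norm_num [Nat.factorial]
  | h1 => rw [H.one]; norm_num [Nat.factorial]
  | hs n ih =>
    rw [H.step]
    have h2 : ∑ p ∈ antidiagonal n, h p.1 * h p.2 ≤
        ∑ p ∈ antidiagonal n, 6 ^ n * (2 * ((n + 2).factorial : ℝ)) := by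
      apply sum_le_sum
      rintro ⟨k, l⟩ hp
      have hkl : k + l = n := mem_antidiagonal.1 hp
      have h3 := mul_le_mul (ih k (by omega)) (ih l (by omega)) (H.pos l).le (by positivity)
      refine h3.trans ?_
      have h4 : ((k + 2).factorial : ℝ) * (l + 2).factorial ≤ 2 * (n + 2).factorial := by
        rw [← hkl]; exact_mod_cast fact_aux2 k l
      calc _ = 6 ^ n * (((k + 2).factorial : ℝ) * (l + 2).factorial) := by
            rw [← hkl, pow_add]; ring
        _ ≤ _ := by gcongr
    rw [sum_const, Nat.card_antidiagonal, nsmul_eq_mul] at h2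
    have ha := mul_le_mul_of_nonneg_left (ih n (by omega)) (cA_pos n).le
    have hb := mul_le_mul_of_nonneg_left (add_le_add (ih (n+1) le_rfl) h2) (cB_pos n).le
    refine (add_le_add ha hb).trans ?_
    rw [show n + 1 + 2 = (n + 2) + 1 by ring, show n + 2 + 2 = (n + 2 + 1) + 1 by ring,
      Nat.factorial_succ (n + 2 + 1), Nat.factorial_succ (n + 2)]
    have key : cA n + cB n * (6 * ((n : ℝ) + 3) + 2 * (n + 1)) ≤ 36 * (n + 3) * (n + 4) := by
      unfold cA cB
      rw [div_mul_eq_mul_div, ← add_div, div_le_iff₀ (by positivity)]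
      have : (0 : ℝ) ≤ n := by positivity
      nlinarith [mul_nonneg this this, mul_nonneg this (mul_nonneg this this)]
    have hp : (0 : ℝ) ≤ 6 ^ n * ((n + 2).factorial : ℝ) := by positivity
    have := mul_le_mul_of_nonneg_right key hp
    push_cast
    calc _ = (cA n + cB n * (6 * ((n : ℝ) + 3) + 2 * (n + 1))) * (6 ^ n * ((n + 2).factorial : ℝ)) := by
          ring
      _ ≤ _ := this
      _ = _ := by ring

lemma IsTotal.step_ge (H : IsTotal h) (n : ℕ) :
    cA n * h n + cB n * h (n + 1) ≤ h (n + 2) := by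
  rw [H.step]
  have h2 : 0 ≤ ∑ p ∈ antidiagonal n, h p.1 * h p.2 :=
    sum_nonneg fun p _ => (mul_pos (H.pos _) (H.pos _)).le
  nlinarith [mul_nonneg (cB_pos n).le h2]

lemma IsTotal.lower (H : IsTotal h) (n : ℕ) :
    6 ^ n * (n.factorial : ℝ) * (n + 4 / 3) ≤ h n := by
  induction n using two_step with
  | h0 => rw [H.zero]; norm_num [Nat.factorial]
  | h1 => rw [H.one]; norm_num [Nat.factorial]
  | hs n ih =>
    refine le_trans ?_ (H.step_ge n)
    have ha := mul_le_mul_of_nonneg_left (ih n (by omega)) (cA_pos n).le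
    have hb := mul_le_mul_of_nonneg_left (ih (n+1) le_rfl) (cB_pos n).le
    refine le_trans ?_ (add_le_add ha hb)
    rw [Nat.factorial_succ (n + 1), Nat.factorial_succ n]
    have key : 36 * ((n : ℝ) + 2) * (n + 1) * (n + 2 + 4 / 3) ≤
        cA n * (n + 4 / 3) + cB n * (6 * (n + 1) * (n + 1 + 4 / 3)) := by
      unfold cA cB
      rw [div_mul_eq_mul_div, div_mul_eq_mul_div, ← add_div, le_div_iff₀ (by positivity)]
      have : (0 : ℝ) ≤ n := by positivity
      nlinarith [mul_nonneg this this, mul_nonneg this (mul_nonneg this this)]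
    have hp : (0 : ℝ) ≤ 6 ^ n * (n.factorial : ℝ) := by positivity
    have := mul_le_mul_of_nonneg_right key hp
    push_cast
    calc _ = 36 * ((n : ℝ) + 2) * (n + 1) * (n + 2 + 4 / 3) * (6 ^ n * (n.factorial : ℝ)) := by ring
      _ ≤ _ := this
      _ = _ := by ring

lemma IsTotal.term_bound (H : IsTotal h) (k l : ℕ) :
    h k * h l ≤ (if k = 0 then 2 * h (k + l) else 0) + (if l = 0 then 2 * h (k + l) else 0)
      + (if k = 1 then 25 * h (k + l) else 0) + (if l = 1 then 25 * h (k + l) else 0)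
      + 24 * (6 ^ (k + l) * ((k + l).factorial : ℝ)) := by
  have hp := H.pos
  have hnn : ∀ (q : Prop) [Decidable q] (c : ℝ), 0 ≤ c → 0 ≤ (if q then c * h (k + l) else 0) := by
    intro q _ c hc
    split_ifs
    · exact mul_nonneg hc (hp _).le
    · exact le_rfl
  have hf : (0 : ℝ) ≤ 24 * (6 ^ (k + l) * ((k + l).factorial : ℝ)) := by positivity
  have e1 := hnn (k = 0) 2 (by norm_num)
  have e2 := hnn (l = 0) 2 (by norm_num)
  have e3 := hnn (k = 1) 25 (by norm_num)
  have e4 := hnn (l = 1) 25 (by norm_num)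
  have hone : ∀ m, h m ≤ h (1 + m) := by
    intro m
    refine (H.crude m).trans (le_trans ?_ (H.lower (1 + m)))
    rw [add_comm 1 m, show m + 2 = m + 1 + 1 by ring, Nat.factorial_succ (m + 1), pow_succ]
    push_cast
    have h0 : (0 : ℝ) ≤ 6 ^ m * ((m + 1).factorial : ℝ) := by positivity
    have hm : (0 : ℝ) ≤ m := by positivity
    nlinarith [mul_nonneg h0 hm]
  by_cases k0 : k = 0
  · subst k0
    rw [if_pos rfl] at *
    simp only [zero_add, H.zero] at *
    linarith
  by_cases l0 : l = 0
  · subst l0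
    rw [if_pos rfl] at *
    simp only [add_zero, H.zero] at *
    linarith
  by_cases k1 : k = 1
  · subst k1
    rw [if_pos (rfl : 1 = 1)] at *
    rw [H.one]
    have := hone l
    linarith
  by_cases l1 : l = 1
  · subst l1
    rw [if_pos (rfl : 1 = 1)] at *
    rw [H.one]
    have := hone k
    rw [add_comm] at this
    linarith
  have : h k * h l ≤ 24 * (6 ^ (k + l) * ((k + l).factorial : ℝ)) := by
    obtain ⟨k, rfl⟩ : ∃ j, k = j + 2 := ⟨k - 2, by omega⟩
    obtain ⟨l, rfl⟩ : ∃ j, l = j + 2 := ⟨l - 2, by omega⟩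
    refine (mul_le_mul (H.crude _) (H.crude _) (hp _).le (by positivity)).trans ?_
    have h4 : ((k + 2 + 2).factorial : ℝ) * (l + 2 + 2).factorial ≤
        24 * (k + 2 + (l + 2)).factorial := by
      rw [show k + 2 + (l + 2) = k + l + 4 by ring]; exact_mod_cast fact_aux4 k l
    calc _ = 6 ^ (k + 2 + (l + 2)) * (((k + 2 + 2).factorial : ℝ) * (l + 2 + 2).factorial) := by
          rw [pow_add 6 (k + 2)]; ring
      _ ≤ 6 ^ (k + 2 + (l + 2)) * (24 * (k + 2 + (l + 2)).factorial) := by gcongr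
      _ = _ := by ring
  linarith

lemma IsTotal.conv_bound (H : IsTotal h) (n : ℕ) :
    ∑ p ∈ antidiagonal n, h p.1 * h p.2 ≤ 78 * h n := by
  have hp := H.pos n
  have h1 : ∑ p ∈ antidiagonal n, h p.1 * h p.2 ≤ ∑ p ∈ antidiagonal n,
      ((if p.1 = 0 then 2 * h n else 0) + (if p.2 = 0 then 2 * h n else 0)
      + (if p.1 = 1 then 25 * h n else 0) + (if p.2 = 1 then 25 * h n else 0)
      + 24 * (6 ^ n * (n.factorial : ℝ))) := by
    apply sum_le_sum
    intro p hp
    have := H.term_bound p.1 p.2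
    rwa [mem_antidiagonal.1 hp] at this
  refine h1.trans ?_
  have ind1 : ∀ (j : ℕ) (c : ℝ), 0 ≤ c →
      ∑ p ∈ antidiagonal n, (if p.1 = j then c else 0) ≤ c := by
    intro j c hc
    rw [Nat.sum_antidiagonal_eq_sum_range_succ (fun a _ => if a = j then c else 0)]
    rw [sum_ite_eq']
    split_ifs <;> linarith
  have ind2 : ∀ (j : ℕ) (c : ℝ), 0 ≤ c →
      ∑ p ∈ antidiagonal n, (if p.2 = j then c else 0) ≤ c := by
    intro j c hc
    rw [← Nat.sum_antidiagonal_swap]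
    exact ind1 j c hc
  simp only [sum_add_distrib]
  have hl := H.lower n
  have h5 : ∑ p ∈ antidiagonal n, 24 * (6 ^ n * (n.factorial : ℝ)) ≤ 24 * h n := by
    rw [sum_const, Nat.card_antidiagonal, nsmul_eq_mul]
    push_cast
    have h0 : (0 : ℝ) ≤ 6 ^ n * (n.factorial : ℝ) := by positivity
    nlinarith
  have a1 := ind1 0 (2 * h n) (by linarith)
  have a2 := ind2 0 (2 * h n) (by linarith)
  have a3 := ind1 1 (25 * h n) (by linarith)
  have a4 := ind2 1 (25 * h n) (by linarith)
  linarith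

end CubicMaps

namespace CubicMaps
variable {h : ℕ → ℝ}

/-- Normalised totals. -/
noncomputable def uu (h : ℕ → ℝ) (n : ℕ) : ℝ := h n / (6 ^ n * n.factorial)

lemma h_eq_uu (h : ℕ → ℝ) (n : ℕ) : h n = 6 ^ n * n.factorial * uu h n := by
  unfold uu; field_simp

lemma IsTotal.uu_pos (H : IsTotal h) (n : ℕ) : 0 < uu h n := by
  have := H.pos n
  unfold uu; positivity

lemma IsTotal.uu_lower (H : IsTotal h) (n : ℕ) : (n : ℝ) + 1 ≤ uu h n := by
  unfold uu
  rw [le_div_iff₀ (by positivity)]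
  have := H.lower n
  have h0 : (0 : ℝ) ≤ 6 ^ n * (n.factorial : ℝ) := by positivity
  nlinarith

lemma IsTotal.uu_step (H : IsTotal h) (n : ℕ) : ∃ e : ℝ, 0 ≤ e ∧
    e ≤ 80 / (((n : ℝ) + 2) * (n + 3)) * uu h n ∧
    uu h (n + 2) = uu h n + e + (2 / ((n : ℝ) + 2) - 2 / (3 * (n + 2) * (n + 3))) * uu h (n + 1) := by
  set T := ∑ p ∈ antidiagonal n, h p.1 * h p.2 with hT
  have hT0 : 0 ≤ T := sum_nonneg fun p _ => (mul_pos (H.pos _) (H.pos _)).le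
  have hT1 : T ≤ 78 * h n := H.conv_bound n
  have hB := cB_pos n
  have hu := H.uu_pos n
  have hF : (0 : ℝ) < 6 ^ n * n.factorial := by positivity
  have hn : (0 : ℝ) ≤ n := by positivity
  refine ⟨(5 / 9) / ((n + 1) * (n + 3)) * uu h n
    + cB n * T / (6 ^ n * n.factorial) / (36 * (n + 1) * (n + 2)), ?_, ?_, ?_⟩
  · positivity
  · have h1 : T / (6 ^ n * n.factorial) ≤ 78 * uu h n := by
      rw [div_le_iff₀ hF]; rw [h_eq_uu h n] at hT1; linarith
    have h2 : cB n * T / (6 ^ n * n.factorial) / (36 * (n + 1) * (n + 2)) ≤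
        cB n * (78 * uu h n) / (36 * (n + 1) * (n + 2)) := by
      rw [mul_div_assoc]
      gcongr
    have h3 : (5 / 9) / (((n : ℝ) + 1) * (n + 3)) + cB n * 78 / (36 * (n + 1) * (n + 2)) ≤
        80 / (((n : ℝ) + 2) * (n + 3)) := by
      have : (5 / 9) / (((n : ℝ) + 1) * (n + 3)) + cB n * 78 / (36 * (n + 1) * (n + 2))
         = ((5 / 9) * (n + 2) + 78 * (3 * n + 8) / 9) / (n + 1) / ((n + 2) * (n + 3)) := by
        unfold cB
        field_simp
        ring
      rw [this]
      gcongr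
      rw [div_le_iff₀ (by positivity)]
      linarith
    have h4 := mul_le_mul_of_nonneg_right h3 hu.le
    calc _ ≤ _ := add_le_add_right h2 _
      _ = ((5 / 9) / (((n : ℝ) + 1) * (n + 3)) + cB n * 78 / (36 * (n + 1) * (n + 2))) * uu h n := by
        ring
      _ ≤ _ := h4
  · have e1 : uu h (n + 2) = (cA n * h n + cB n * (h (n + 1) + T)) /
        (6 ^ (n + 2) * (n + 2).factorial) := by
      rw [hT, ← H.step]; rfl
    rw [e1, h_eq_uu h n, h_eq_uu h (n + 1), Nat.factorial_succ (n + 1), Nat.factorial_succ n]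
    unfold cA cB
    push_cast
    field_simp
    ring

lemma IsTotal.uu_upper (H : IsTotal h) : ∃ K : ℝ, 0 < K ∧ ∀ n : ℕ, uu h n ≤ K * (n + 1) := by
  refine ⟨3 * Real.exp 80, by positivity, fun n => ?_⟩
  have main : uu h n ≤ 3 * Real.exp 80 * Real.exp (-80 / ((n : ℝ) + 1)) * (n + 1) := by
    induction n using two_step with
    | h0 =>
      rw [mul_assoc 3, ← Real.exp_add]
      simp [uu, H.zero]
      norm_num
    | h1 =>
      rw [mul_assoc 3, ← Real.exp_add]
      have : (1 : ℝ) ≤ Real.exp (80 + -80 / (((1 : ℕ) : ℝ) + 1)) :=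
        Real.one_le_exp (by norm_num)
      have h2 : uu h 1 = 25 / 6 := by simp [uu, H.one]
      rw [h2]; push_cast at *; linarith
    | hs n ih =>
      obtain ⟨e, he0, he1, hs⟩ := H.uu_step n
      have hn : (0 : ℝ) ≤ n := by positivity
      have i0 := ih n (by omega)
      have i1 := ih (n + 1) le_rfl
      set K := 3 * Real.exp 80 with hK
      have hKp : 0 < K := by positivity
      set X := K * Real.exp (-80 / ((n : ℝ) + 2)) with hX
      have hXp : 0 < X := by positivity
      have j1 : uu h (n + 1) ≤ X * (n + 2) := by
        have : ((n + 1 : ℕ) : ℝ) + 1 = n + 2 := by push_cast; ring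
        rw [this] at i1; exact i1
      have j0 : uu h n ≤ X * (n + 1) := by
        refine i0.trans ?_
        rw [hX]
        gcongr ?_ * Real.exp ?_ * _
        rw [neg_div, neg_div, neg_le_neg_iff]
        gcongr; norm_num
      have hd : (2 / ((n : ℝ) + 2) - 2 / (3 * (n + 2) * (n + 3))) * uu h (n + 1) ≤ X * 2 := by
        have h1 : 0 ≤ 2 / (3 * ((n : ℝ) + 2) * (n + 3)) * uu h (n + 1) := by
          have := H.uu_pos (n + 1)
          positivity
        have h2 : 2 / ((n : ℝ) + 2) * uu h (n + 1) ≤ 2 / ((n : ℝ) + 2) * (X * (n + 2)) := by gcongr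
        have h3 : 2 / ((n : ℝ) + 2) * (X * (n + 2)) = X * 2 := by field_simp
        linarith
      set m := 80 / (((n : ℝ) + 2) * (n + 3)) with hm
      have hmp : 0 ≤ m := by positivity
      have h5 : uu h (n + 2) ≤ X * (1 + m) * (n + 3) := by
        have : m * uu h n ≤ m * (X * (n + 1)) := by gcongr
        have h6 : 0 ≤ X * m := by positivity
        rw [hs]
        nlinarith
      refine h5.trans ?_
      have h7 : 1 + m ≤ Real.exp m := by linarith [Real.add_one_le_exp m]
      have h8 : Real.exp (-80 / ((n : ℝ) + 2)) * Real.exp m = Real.exp (-80 / ((n : ℝ) + 3)) := by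
        rw [← Real.exp_add]
        congr 1
        rw [hm]; field_simp; ring
      have : ((n + 2 : ℕ) : ℝ) + 1 = n + 3 := by push_cast; ring
      rw [this, ← h8, hX]
      calc _ ≤ K * Real.exp (-80 / ((n : ℝ) + 2)) * Real.exp m * (n + 3) := by gcongr
        _ = _ := by ring
  refine main.trans ?_
  have : Real.exp (-80 / ((n : ℝ) + 1)) ≤ 1 := by
    rw [Real.exp_le_one_iff]
    have : (0 : ℝ) ≤ 80 / ((n : ℝ) + 1) := by positivity
    rw [neg_div]; linarith
  have hp : (0 : ℝ) ≤ 3 * Real.exp 80 * (n + 1) := by positivity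
  nlinarith

lemma IsTotal.E_bound (H : IsTotal h) : ∃ C : ℝ, 0 < C ∧ ∀ n : ℕ,
    |((n : ℝ) + 1) * uu h (n + 1) - (n + 2) * uu h n| ≤ C * (n + 1) := by
  obtain ⟨K, hK, hu⟩ := H.uu_upper
  refine ⟨100 * K + |uu h 1 - 2 * uu h 0|, by positivity, fun n => ?_⟩
  induction n with
  | zero => simp; linarith
  | succ n ih =>
    obtain ⟨e, he0, he1, hs⟩ := H.uu_step n
    have hn : (0 : ℝ) ≤ n := by positivity
    rw [show n + 1 + 1 = n + 2 by ring, hs]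
    push_cast
    have key : ((n : ℝ) + 1 + 1) * (uu h n + e + (2 / ((n : ℝ) + 2) - 2 / (3 * (n + 2) * (n + 3)))
        * uu h (n + 1)) - (n + 1 + 2) * uu h (n + 1)
        = -(((n : ℝ) + 1) * uu h (n + 1) - (n + 2) * uu h n) + (n + 2) * e
          - 2 / (3 * (n + 3)) * uu h (n + 1) := by
      field_simp
      ring
    rw [key]
    have b1 : (n + 2) * e ≤ 80 * K := by
      have : (n + 2) * e ≤ ((n : ℝ) + 2) * (80 / (((n : ℝ) + 2) * (n + 3)) * (K * (n + 1))) := by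
        gcongr
        refine he1.trans ?_
        gcongr
        exact hu n
      refine this.trans ?_
      have : ((n : ℝ) + 2) * (80 / (((n : ℝ) + 2) * (n + 3)) * (K * (n + 1))) =
        80 * K * ((n + 1) / (n + 3)) := by field_simp
      rw [this]
      have h1 : ((n : ℝ) + 1) / (n + 3) ≤ 1 := by rw [div_le_one (by positivity)]; linarith
      nlinarith
    have b2 : 2 / (3 * ((n : ℝ) + 3)) * uu h (n + 1) ≤ K := by
      have h1 := hu (n + 1)
      push_cast at h1
      rw [div_mul_eq_mul_div, div_le_iff₀ (by positivity)]
      nlinarith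
    have b3 : 0 ≤ 2 / (3 * ((n : ℝ) + 3)) * uu h (n + 1) := by
      have := H.uu_pos (n + 1)
      positivity
    have b4 : 0 ≤ ((n : ℝ) + 2) * e := by positivity
    have := abs_nonneg (uu h 1 - 2 * uu h 0)
    rw [abs_le] at ih ⊢
    constructor <;> nlinarith [ih.1, ih.2]

/-- Transition weights. -/
noncomputable def wa (h : ℕ → ℝ) (n : ℕ) : ℝ := cA n * h n / h (n + 2)
noncomputable def wb (h : ℕ → ℝ) (n : ℕ) : ℝ := cB n * h (n + 1) / h (n + 2)
noncomputable def wc (h : ℕ → ℝ) (n : ℕ) : ℝ :=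
  cB n * (∑ p ∈ antidiagonal n, h p.1 * h p.2) / h (n + 2)

lemma IsTotal.wa_nonneg (H : IsTotal h) (n : ℕ) : 0 ≤ wa h n := by
  have := H.pos; have := cA_pos n
  unfold wa; exact (div_pos (mul_pos this (H.pos _)) (H.pos _)).le
lemma IsTotal.wb_nonneg (H : IsTotal h) (n : ℕ) : 0 ≤ wb h n := by
  have := H.pos; have := cB_pos n
  unfold wb; exact (div_pos (mul_pos this (H.pos _)) (H.pos _)).le
lemma IsTotal.wc_nonneg (H : IsTotal h) (n : ℕ) : 0 ≤ wc h n := by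
  have h2 : 0 ≤ ∑ p ∈ antidiagonal n, h p.1 * h p.2 :=
    sum_nonneg fun p _ => (mul_pos (H.pos _) (H.pos _)).le
  unfold wc; exact div_nonneg (mul_nonneg (cB_pos n).le h2) (H.pos _).le

lemma IsTotal.w_sum (H : IsTotal h) (n : ℕ) : wa h n + wb h n + wc h n = 1 := by
  unfold wa wb wc
  rw [← add_div, ← add_div, div_eq_one_iff_eq (H.pos _).ne', H.step]
  ring

lemma IsTotal.wc_le (H : IsTotal h) (n : ℕ) : wc h n ≤ 78 / ((n : ℝ) + 2) ^ 2 * 2 := by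
  have h1 := H.step_ge n
  have hp := H.pos
  have h2 : cA n * h n ≤ h (n + 2) := by
    have := mul_pos (cB_pos n) (hp (n + 1)); linarith
  unfold wc
  have hA := mul_pos (cA_pos n) (hp n)
  have hB := cB_pos n
  have := hp n
  calc _ ≤ cB n * (78 * h n) / (cA n * h n) := by
        gcongr
        exact H.conv_bound n
    _ = 78 / (((n : ℝ) + 2) * (3 * n + 4)) := by
        unfold cA cB
        field_simp
    _ ≤ 78 / (((n : ℝ) + 2) * ((n + 2) / 2)) := by
        gcongr
        have : (0 : ℝ) ≤ n := by positivity
        linarith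
    _ = _ := by field_simp

lemma IsTotal.wb_close (H : IsTotal h) : ∃ C : ℝ, 0 < C ∧ ∀ n : ℕ,
    |wb h n - 2 / ((n : ℝ) + 2)| ≤ C / ((n : ℝ) + 2) ^ 2 := by
  obtain ⟨C, hC, hE⟩ := H.E_bound
  refine ⟨10 + 10 * C, by positivity, fun n => ?_⟩
  have hn : (0 : ℝ) ≤ n := by positivity
  have h1 := hE (n + 1)
  have u2 := H.uu_lower (n + 2)
  have u2p := H.uu_pos (n + 2)
  push_cast at h1 u2
  rw [show n + 1 + 1 = n + 2 by ring] at h1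
  set E := ((n : ℝ) + 1 + 1) * uu h (n + 2) - (n + 1 + 2) * uu h (n + 1) with hEdef
  have q : uu h (n + 1) = (((n : ℝ) + 2) * uu h (n + 2) - E) / (n + 3) := by
    rw [hEdef]; field_simp; ring
  have e1 : wb h n = (2 * (3 * (n : ℝ) + 8)) / (3 * (n + 2) * (n + 3)) * (uu h (n + 1) / uu h (n + 2)) := by
    unfold wb cB
    rw [h_eq_uu h (n + 1), h_eq_uu h (n + 2), Nat.factorial_succ (n + 1)]
    push_cast
    field_simp
    ring
  have e2 : wb h n - 2 / ((n : ℝ) + 2) =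
     -((2 * (4 * (n : ℝ) + 11)) / (3 * (n + 2) * (n + 3) ^ 2)) -
     (2 * (3 * (n : ℝ) + 8)) / (3 * (n + 2) * (n + 3) ^ 2) * (E / uu h (n + 2)) := by
    rw [e1, q]
    field_simp
    ring
  have b1 : |E / uu h (n + 2)| ≤ C := by
    rw [abs_div, abs_of_pos u2p, div_le_iff₀ u2p]
    nlinarith
  have b2 : (2 * (4 * (n : ℝ) + 11)) / (3 * (n + 2) * (n + 3) ^ 2) ≤ 10 / ((n : ℝ) + 2) ^ 2 := by
    rw [div_le_div_iff₀ (by positivity) (by positivity)]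
    nlinarith [mul_nonneg hn hn, mul_nonneg hn (mul_nonneg hn hn)]
  have b3 : (2 * (3 * (n : ℝ) + 8)) / (3 * (n + 2) * (n + 3) ^ 2) ≤ 10 / ((n : ℝ) + 2) ^ 2 := by
    rw [div_le_div_iff₀ (by positivity) (by positivity)]
    nlinarith [mul_nonneg hn hn, mul_nonneg hn (mul_nonneg hn hn)]
  rw [e2]
  have b4 : 0 ≤ (2 * (4 * (n : ℝ) + 11)) / (3 * (n + 2) * (n + 3) ^ 2) := by positivity
  have b5 : 0 ≤ (2 * (3 * (n : ℝ) + 8)) / (3 * (n + 2) * (n + 3) ^ 2) := by positivity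
  calc _ ≤ _ := abs_sub _ _
    _ = (2 * (4 * (n : ℝ) + 11)) / (3 * (n + 2) * (n + 3) ^ 2) +
       (2 * (3 * (n : ℝ) + 8)) / (3 * (n + 2) * (n + 3) ^ 2) * |E / uu h (n + 2)| := by
        rw [abs_neg, abs_mul, abs_of_nonneg b4, abs_of_nonneg b5]
    _ ≤ 10 / ((n : ℝ) + 2) ^ 2 + 10 / ((n : ℝ) + 2) ^ 2 * C := by gcongr
    _ = _ := by ring

end CubicMaps

namespace CubicMaps
variable {h : ℕ → ℝ}

lemma max_principle {d a b e S : ℕ → ℝ} {N : ℕ} {D : ℝ}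
    (ha : ∀ n, 0 ≤ a n) (hb : ∀ n, 0 ≤ b n) (hab : ∀ n, a n + b n ≤ 1)
    (hd : ∀ n, N ≤ n → d (n + 2) ≤ a n * d n + b n * d (n + 1) + e n)
    (hD : 0 ≤ D) (h0 : d N ≤ D) (h1 : d (N + 1) ≤ D)
    (hS0 : ∀ n, N ≤ n → 0 ≤ S n) (hSm : ∀ n, N ≤ n → S n ≤ S (n + 1))
    (hS : ∀ n, N ≤ n → S (n + 1) + e n ≤ S (n + 2)) :
    ∀ n, N ≤ n → d n ≤ D + S n := by
  intro n hn
  obtain ⟨m, rfl⟩ := Nat.exists_eq_add_of_le hn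
  clear hn
  induction m using two_step with
  | h0 => have := hS0 N le_rfl; simp; linarith
  | h1 => have := hS0 (N + 1) (by omega); linarith
  | hs m ih =>
    have i0 := ih m (by omega)
    have i1 := ih (m + 1) le_rfl
    have h2 := hd (N + m) (by omega)
    have h3 := hS (N + m) (by omega)
    have h4 := hSm (N + m) (by omega)
    have h5 := hS0 (N + m + 1) (by omega)
    rw [← add_assoc] at i1 ⊢
    set n := N + m
    have j0 : a n * d n ≤ a n * (D + S (n + 1)) := mul_le_mul_of_nonneg_left (by linarith) (ha n)
    have j1 : b n * d (n + 1) ≤ b n * (D + S (n + 1)) := mul_le_mul_of_nonneg_left i1 (hb n)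
    have j2 := mul_le_mul_of_nonneg_right (hab n) (show 0 ≤ D + S (n + 1) by linarith)
    nlinarith

/-- Twisted totals: the generating polynomial evaluated at `x`. -/
structure IsTwist (h : ℕ → ℝ) (x : ℂ) (P : ℕ → ℂ) : Prop where
  bound : ∀ n, ‖P n‖ ≤ h n
  step : ∀ n, P (n + 2) = cA n * P n + cB n * (x * P (n + 1) + ∑ p ∈ antidiagonal n, P p.1 * P p.2)

/-- The comparison sequence `n ^ (x - 1)`. -/
noncomputable def sv (x : ℂ) (n : ℕ) : ℂ := Complex.exp ((x - 1) * (Real.log n : ℝ))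

lemma sv_norm_le {x : ℂ} (hx : ‖x‖ = 1) (n : ℕ) : ‖sv x n‖ ≤ 1 := by
  unfold sv
  rw [Complex.norm_exp, Real.exp_le_one_iff, Complex.re_mul_ofReal]
  have h1 : (x - 1).re ≤ 0 := by
    have := Complex.re_le_norm x
    simp; linarith
  exact mul_nonpos_of_nonpos_of_nonneg h1 (Real.log_natCast_nonneg n)

lemma log_diff2 {n : ℕ} (hn : 1 ≤ n) :
    0 ≤ Real.log (n + 2 : ℕ) - Real.log n - 2 / ((n : ℝ) + 2) ∧
    Real.log (n + 2 : ℕ) - Real.log n - 2 / ((n : ℝ) + 2) ≤ 4 / (n : ℝ) ^ 2 ∧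
    Real.log (n + 2 : ℕ) - Real.log n ≤ 2 / (n : ℝ) := by
  have hn' : (1 : ℝ) ≤ n := by exact_mod_cast hn
  have e : Real.log (n + 2 : ℕ) - Real.log n = Real.log (((n : ℝ) + 2) / n) := by
    rw [Real.log_div (by positivity) (by positivity)]; push_cast; rfl
  have l1 := Real.one_sub_inv_le_log_of_pos (show 0 < ((n : ℝ) + 2) / n by positivity)
  have l2 := Real.log_le_sub_one_of_pos (show 0 < ((n : ℝ) + 2) / n by positivity)
  have e1 : 1 - (((n : ℝ) + 2) / n)⁻¹ = 2 / (n + 2) := by field_simp; ring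
  have e2 : ((n : ℝ) + 2) / n - 1 = 2 / n := by field_simp; ring
  rw [e1] at l1
  rw [e2] at l2
  rw [e]
  have e3 : 2 / (n : ℝ) - 2 / (n + 2) ≤ 4 / (n : ℝ) ^ 2 := by
    have : 2 / (n : ℝ) - 2 / (n + 2) = 4 / (n * (n + 2)) := by field_simp; ring
    rw [this, pow_two]
    gcongr
    linarith
  refine ⟨by linarith, by linarith, l2⟩

lemma log_diff1 {n : ℕ} (hn : 1 ≤ n) :
    0 ≤ Real.log (n + 1 : ℕ) - Real.log n ∧ Real.log (n + 1 : ℕ) - Real.log n ≤ 1 / (n : ℝ) := by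
  have hn' : (1 : ℝ) ≤ n := by exact_mod_cast hn
  have e : Real.log (n + 1 : ℕ) - Real.log n = Real.log (((n : ℝ) + 1) / n) := by
    rw [Real.log_div (by positivity) (by positivity)]; push_cast; rfl
  have l2 := Real.log_le_sub_one_of_pos (show 0 < ((n : ℝ) + 1) / n by positivity)
  have e2 : ((n : ℝ) + 1) / n - 1 = 1 / n := by field_simp; ring
  rw [e2] at l2
  rw [e]
  refine ⟨Real.log_nonneg ?_, l2⟩
  rw [one_le_div (by positivity)]; linarith

lemma IsTotal.w_bounds (H : IsTotal h) : ∃ C : ℝ, 1 ≤ C ∧ ∀ n : ℕ, 1 ≤ n →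
    wc h n ≤ C / (n : ℝ) ^ 2 ∧ |2 / ((n : ℝ) + 2) - wb h n| ≤ C / (n : ℝ) ^ 2 ∧
    wb h n ≤ C / n := by
  obtain ⟨C, hC, hw⟩ := H.wb_close
  refine ⟨156 + C + 2, by linarith, fun n hn => ?_⟩
  have hn' : (1 : ℝ) ≤ n := by exact_mod_cast hn
  have h1 : |wb h n - 2 / ((n : ℝ) + 2)| ≤ C / (n : ℝ) ^ 2 := by
    refine (hw n).trans ?_
    gcongr; linarith
  refine ⟨?_, ?_, ?_⟩
  · refine (H.wc_le n).trans ?_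
    rw [div_mul_eq_mul_div]
    gcongr
    · linarith
    · linarith
  · rw [abs_sub_comm]
    refine h1.trans ?_
    gcongr; linarith
  · have h2 := (abs_le.1 h1).2
    have h3 : 2 / ((n : ℝ) + 2) ≤ 2 / n := by gcongr; linarith
    have h4 : C / (n : ℝ) ^ 2 ≤ C / n := by
      gcongr; nlinarith
    have h5 : (156 + C + 2) / (n : ℝ) = 156 / n + C / n + 2 / n := by ring
    have h6 : 0 ≤ 156 / (n : ℝ) := by positivity
    linarith

lemma IsTotal.sv_residual (H : IsTotal h) : ∃ C : ℝ, 0 < C ∧ ∀ x : ℂ, ‖x‖ = 1 → ∀ n : ℕ, 4 ≤ n →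
    ‖sv x (n + 2) - wa h n * sv x n - wb h n * x * sv x (n + 1)‖ + wc h n ≤ C / (n : ℝ) ^ 2 := by
  obtain ⟨C, hC, hw⟩ := H.w_bounds
  refine ⟨24 + C + 2 * C + 4 * C + C, by positivity, fun x hx n hn => ?_⟩
  obtain ⟨w1, w2, w3⟩ := hw n (by omega)
  obtain ⟨l1, l2, l3⟩ := log_diff2 (show 1 ≤ n by omega)
  obtain ⟨m1, m2⟩ := log_diff1 (show 1 ≤ n by omega)
  have hn' : (4 : ℝ) ≤ n := by exact_mod_cast hn
  set δ := Real.log (n + 2 : ℕ) - Real.log n with hδ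
  set ε := Real.log (n + 1 : ℕ) - Real.log n with hε
  set z := x - 1 with hz
  have hz2 : ‖z‖ ≤ 2 := by
    calc ‖z‖ ≤ ‖x‖ + ‖(1 : ℂ)‖ := norm_sub_le _ _
      _ = 2 := by rw [hx]; norm_num
  have s0 := sv_norm_le hx n
  have e2 : sv x (n + 2) = sv x n * Complex.exp (z * δ) := by
    unfold sv
    rw [← Complex.exp_add, hδ]; congr 1; push_cast; ring
  have e1 : sv x (n + 1) = sv x n * Complex.exp (z * ε) := by
    unfold sv
    rw [← Complex.exp_add, hε]; congr 1; push_cast; ring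
  have hδ0 : 0 ≤ δ := by
    have : 0 ≤ 2 / ((n : ℝ) + 2) := by positivity
    linarith
  have hzδ : ‖z * δ‖ ≤ 4 / n := by
    rw [norm_mul, Complex.norm_of_nonneg hδ0]
    calc _ ≤ 2 * (2 / (n : ℝ)) := by gcongr
      _ = _ := by ring
  have hzε : ‖z * ε‖ ≤ 2 / n := by
    rw [norm_mul, Complex.norm_of_nonneg m1]
    calc _ ≤ 2 * (1 / (n : ℝ)) := by gcongr
      _ = _ := by ring
  have h41 : 4 / (n : ℝ) ≤ 1 := by rw [div_le_one (by positivity)]; linarith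
  have h21 : 2 / (n : ℝ) ≤ 1 := by rw [div_le_one (by positivity)]; linarith
  have X1 : ‖Complex.exp (z * δ) - 1 - z * δ‖ ≤ 16 / (n : ℝ) ^ 2 := by
    refine (Complex.norm_exp_sub_one_sub_id_le (hzδ.trans h41)).trans ?_
    calc _ ≤ (4 / (n : ℝ)) ^ 2 := by gcongr
      _ = _ := by ring
  have X2 : ‖Complex.exp (z * ε) - 1‖ ≤ 4 / (n : ℝ) := by
    refine (Complex.norm_exp_sub_one_le (hzε.trans h21)).trans ?_
    calc _ ≤ 2 * (2 / (n : ℝ)) := by gcongr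
      _ = _ := by ring
  have X3 : ‖z * ((δ - 2 / ((n : ℝ) + 2) : ℝ) : ℂ)‖ ≤ 8 / (n : ℝ) ^ 2 := by
    rw [norm_mul, Complex.norm_of_nonneg l1]
    calc _ ≤ 2 * (4 / (n : ℝ) ^ 2) := by gcongr
      _ = _ := by ring
  have X4 : ‖z * ((2 / ((n : ℝ) + 2) - wb h n : ℝ) : ℂ)‖ ≤ 2 * C / (n : ℝ) ^ 2 := by
    rw [norm_mul, Complex.norm_real, Real.norm_eq_abs]
    calc _ ≤ 2 * (C / (n : ℝ) ^ 2) := by gcongr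
      _ = _ := by ring
  have X5 : ‖(wb h n : ℂ) * x * (Complex.exp (z * ε) - 1)‖ ≤ 4 * C / (n : ℝ) ^ 2 := by
    rw [norm_mul, norm_mul, hx, Complex.norm_of_nonneg (H.wb_nonneg n), mul_one]
    calc _ ≤ C / n * (4 / (n : ℝ)) := by gcongr
      _ = _ := by ring
  have X6 : ‖((wc h n : ℝ) : ℂ)‖ ≤ C / (n : ℝ) ^ 2 := by
    rw [Complex.norm_of_nonneg (H.wc_nonneg n)]; exact w1
  have hwa : ((wa h n : ℝ) : ℂ) = 1 - wb h n - wc h n := by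
    have := H.w_sum n
    rw [show wa h n = 1 - wb h n - wc h n by linarith]; push_cast; ring
  have key : sv x (n + 2) - wa h n * sv x n - wb h n * x * sv x (n + 1) =
      sv x n * ((Complex.exp (z * δ) - 1 - z * δ) + z * ((δ - 2 / ((n : ℝ) + 2) : ℝ) : ℂ)
        + z * ((2 / ((n : ℝ) + 2) - wb h n : ℝ) : ℂ) + ((wc h n : ℝ) : ℂ)
        - (wb h n : ℂ) * x * (Complex.exp (z * ε) - 1)) := by
    rw [e2, e1, hwa]
    push_cast
    rw [hz]; ring
  have tri : ‖(Complex.exp (z * δ) - 1 - z * δ) + z * ((δ - 2 / ((n : ℝ) + 2) : ℝ) : ℂ)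
        + z * ((2 / ((n : ℝ) + 2) - wb h n : ℝ) : ℂ) + ((wc h n : ℝ) : ℂ)
        - (wb h n : ℂ) * x * (Complex.exp (z * ε) - 1)‖ ≤
      16 / (n : ℝ) ^ 2 + 8 / (n : ℝ) ^ 2 + 2 * C / (n : ℝ) ^ 2 + C / (n : ℝ) ^ 2
        + 4 * C / (n : ℝ) ^ 2 := by
    refine (norm_sub_le _ _).trans (add_le_add ?_ X5)
    refine (norm_add_le _ _).trans (add_le_add ?_ X6)
    refine (norm_add_le _ _).trans (add_le_add ?_ X4)
    exact (norm_add_le _ _).trans (add_le_add X1 X3)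
  rw [key, norm_mul]
  calc _ ≤ 1 * (16 / (n : ℝ) ^ 2 + 8 / (n : ℝ) ^ 2 + 2 * C / (n : ℝ) ^ 2 + C / (n : ℝ) ^ 2
        + 4 * C / (n : ℝ) ^ 2) + C / (n : ℝ) ^ 2 := by gcongr
    _ = _ := by ring

lemma IsTotal.compare (H : IsTotal h) : ∃ C : ℝ, 0 < C ∧ ∀ (x : ℂ) (P : ℕ → ℂ), ‖x‖ = 1 →
    IsTwist h x P → ∀ N : ℕ, 4 ≤ N → ∀ n, N ≤ n →
    ‖P n / h n - sv x n‖ ≤ ‖P N / h N - sv x N‖ + ‖P (N + 1) / h (N + 1) - sv x (N + 1)‖ + C / N := by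
  obtain ⟨C, hC, hres⟩ := H.sv_residual
  refine ⟨4 * C, by positivity, fun x P hx hP N hN n hn => ?_⟩
  have hN' : (4 : ℝ) ≤ N := by exact_mod_cast hN
  have main := max_principle (d := fun n => ‖P n / h n - sv x n‖) (a := wa h) (b := wb h)
    (e := fun n => C / (n : ℝ) ^ 2) (S := fun n => 4 * C * (1 / N - 1 / n)) (N := N)
    (D := ‖P N / h N - sv x N‖ + ‖P (N + 1) / h (N + 1) - sv x (N + 1)‖)
    H.wa_nonneg H.wb_nonneg (fun n => by have := H.w_sum n; have := H.wc_nonneg n; linarith)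
    ?_ (by positivity) (le_add_of_nonneg_right (norm_nonneg _))
    (le_add_of_nonneg_left (norm_nonneg _)) ?_ ?_ ?_ n hn
  · refine main.trans ?_
    have h1 : (0 : ℝ) ≤ 1 / n := by positivity
    have : 4 * C * (1 / (N : ℝ) - 1 / n) ≤ 4 * C / N := by
      rw [mul_sub, mul_one_div]
      nlinarith
    linarith
  · intro m hm
    have hp := H.pos
    have r := hres x hx m (by omega)
    have hne : ∀ k, ((h k : ℝ) : ℂ) ≠ 0 := fun k => by exact_mod_cast (hp k).ne'
    have id1 : P (m + 2) / h (m + 2) - sv x (m + 2) =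
        (wa h m : ℂ) * (P m / h m - sv x m) + wb h m * x * (P (m + 1) / h (m + 1) - sv x (m + 1))
        - (sv x (m + 2) - wa h m * sv x m - wb h m * x * sv x (m + 1))
        + cB m * (∑ p ∈ antidiagonal m, P p.1 * P p.2) / h (m + 2) := by
      rw [hP.step]
      unfold wa wb
      push_cast
      have a1 := hne m
      have a2 := hne (m + 1)
      have a3 := hne (m + 2)
      field_simp
      ring
    have b4 : ‖(cB m : ℂ) * (∑ p ∈ antidiagonal m, P p.1 * P p.2) / h (m + 2)‖ ≤ wc h m := by
      rw [norm_div, norm_mul, Complex.norm_of_nonneg (cB_pos m).le,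
        Complex.norm_of_nonneg (hp _).le]
      unfold wc
      have := hp (m + 2)
      have := cB_pos m
      gcongr
      refine (norm_sum_le _ _).trans (sum_le_sum fun p _ => ?_)
      rw [norm_mul]
      exact mul_le_mul (hP.bound _) (hP.bound _) (norm_nonneg _) (hp _).le
    rw [id1]
    refine (norm_add_le _ _).trans ?_
    have b1 := norm_sub_le ((wa h m : ℂ) * (P m / h m - sv x m)
      + wb h m * x * (P (m + 1) / h (m + 1) - sv x (m + 1)))
      (sv x (m + 2) - wa h m * sv x m - wb h m * x * sv x (m + 1))
    have b2 := norm_add_le ((wa h m : ℂ) * (P m / h m - sv x m))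
      (wb h m * x * (P (m + 1) / h (m + 1) - sv x (m + 1)))
    rw [norm_mul, norm_mul, norm_mul, hx, Complex.norm_of_nonneg (H.wa_nonneg m),
      Complex.norm_of_nonneg (H.wb_nonneg m), mul_one] at b2
    linarith
  · intro m hm
    have : (N : ℝ) ≤ m := by exact_mod_cast hm
    have h1 : 1 / (m : ℝ) ≤ 1 / N := by gcongr
    have : 0 ≤ 1 / (N : ℝ) - 1 / m := by linarith
    positivity
  · intro m hm
    have : (N : ℝ) ≤ m := by exact_mod_cast hm
    have hmp : (0 : ℝ) < m := by linarith
    have h1 : 1 / ((m + 1 : ℕ) : ℝ) ≤ 1 / m := by gcongr; simp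
    gcongr
  · intro m hm
    have : (N : ℝ) ≤ m := by exact_mod_cast hm
    have hmp : (4 : ℝ) ≤ m := by linarith
    push_cast
    have : C / (m : ℝ) ^ 2 ≤ 4 * C * (1 / (m + 1) - 1 / (m + 2)) := by
      have : 4 * C * (1 / ((m : ℝ) + 1) - 1 / (m + 2)) = 4 * C / ((m + 1) * (m + 2)) := by
        field_simp; ring
      rw [this, div_le_div_iff₀ (by positivity) (by positivity)]
      have : ((m : ℝ) + 1) * (m + 2) ≤ 4 * m ^ 2 := by nlinarith
      nlinarith
    linarith

end CubicMaps

namespace CubicMaps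
variable {h : ℕ → ℝ}

lemma IsTotal.diff_tendsto (H : IsTotal h) (P : ℕ → ℂ → ℂ)
    (hP : ∀ x : ℂ, ‖x‖ = 1 → IsTwist h x (fun n => P n x))
    (hc : ∀ n, ContinuousAt (P n) 1) (h1 : ∀ n, P n 1 = h n)
    (x : ℕ → ℂ) (hx : ∀ n, ‖x n‖ = 1) (hx1 : Tendsto x atTop (nhds 1)) :
    Tendsto (fun n => P n (x n) / h n - sv (x n) n) atTop (nhds 0) := by
  obtain ⟨C, hC, hcomp⟩ := H.compare
  have hN : ∀ N : ℕ, Tendsto (fun n => ‖P N (x n) / h N - sv (x n) N‖) atTop (nhds 0) := by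
    intro N
    have a1 : Tendsto (fun n => P N (x n)) atTop (nhds (h N : ℂ)) := by
      rw [← h1]; exact (hc N).tendsto.comp hx1
    have a2 : Tendsto (fun n => sv (x n) N) atTop (nhds 1) := by
      have : Continuous (fun y : ℂ => sv y N) := by unfold sv; fun_prop
      have h3 := (this.tendsto 1).comp hx1
      have e : sv 1 N = 1 := by simp [sv]
      rw [e] at h3
      exact h3
    have a3 := ((a1.div_const (h N : ℂ)).sub a2).norm
    have : (h N : ℂ) ≠ 0 := by exact_mod_cast (H.pos N).ne'
    rwa [div_self this, sub_self, norm_zero] at a3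
  rw [Metric.tendsto_atTop]
  intro ε hε
  obtain ⟨N₀, hN₀⟩ := exists_nat_gt (C / (ε / 3))
  set N := max N₀ 4 with hNd
  have hN4 : 4 ≤ N := le_max_right _ _
  have hCN : C / N < ε / 3 := by
    have h2 : (N₀ : ℝ) ≤ N := by exact_mod_cast le_max_left _ _
    have h3 : (0 : ℝ) < N := by exact_mod_cast (show 0 < N by omega)
    rw [div_lt_iff₀ (by positivity)] at hN₀
    rw [div_lt_iff₀ h3]
    nlinarith
  have e1 := (hN N).eventually (gt_mem_nhds (show 0 < ε / 3 by positivity))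
  have e2 := (hN (N + 1)).eventually (gt_mem_nhds (show 0 < ε / 3 by positivity))
  obtain ⟨M, hM⟩ := eventually_atTop.1 (e1.and e2)
  refine ⟨max M N, fun n hn => ?_⟩
  obtain ⟨f1, f2⟩ := hM n (le_trans (le_max_left _ _) hn)
  have := hcomp (x n) (fun n' => P n' (x n)) (hx n) (hP _ (hx n)) N hN4 n
    (le_trans (le_max_right _ _) hn)
  rw [dist_zero_right]
  linarith

lemma tendsto_sqrt_log : Tendsto (fun n : ℕ => Real.sqrt (Real.log n)) atTop atTop :=
  Real.tendsto_sqrt_atTop.comp (Real.tendsto_log_atTop.comp tendsto_natCast_atTop_atTop)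

lemma sv_tendsto (θ : ℝ) : Tendsto (fun n : ℕ =>
    sv (Complex.exp ((θ / Real.sqrt (Real.log n) : ℝ) * Complex.I)) n
      * Complex.exp (-((θ * Real.sqrt (Real.log n) : ℝ) * Complex.I))) atTop
    (nhds (Complex.exp (-(θ : ℂ) ^ 2 / 2))) := by
  set q : ℕ → ℝ := fun n => Real.sqrt (Real.log n) with hq
  have hqt : Tendsto q atTop atTop := tendsto_sqrt_log
  set w : ℕ → ℂ := fun n => ((θ / q n : ℝ) : ℂ) * Complex.I with hw
  have hwn : ∀ n, ‖w n‖ = |θ| / |q n| := by intro n; simp [hw]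
  have hw0 : Tendsto (fun n => ‖w n‖) atTop (nhds 0) := by
    simp only [hwn]
    exact (tendsto_abs_atTop_atTop.comp hqt).const_div_atTop _
  -- the third-order error
  have herr : Tendsto (fun n => ((q n : ℂ)) ^ 2 * (Complex.exp (w n) - 1 - w n - (w n) ^ 2 / 2))
      atTop (nhds 0) := by
    rw [tendsto_zero_iff_norm_tendsto_zero]
    have hb : Tendsto (fun n => θ ^ 2 * ‖w n‖) atTop (nhds 0) := by
      simpa using hw0.const_mul (θ ^ 2)
    refine squeeze_zero' (Eventually.of_forall fun n => norm_nonneg _) ?_ hb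
    filter_upwards [hw0.eventually (gt_mem_nhds one_pos), hqt.eventually_gt_atTop 0] with n hn hqn
    have h3 := Complex.exp_bound hn.le (n := 3) (by norm_num)
    simp only [sum_range_succ, range_zero, sum_empty, Nat.factorial] at h3
    have e : Complex.exp (w n) - 1 - w n - (w n) ^ 2 / 2 =
      Complex.exp (w n) - (0 + w n ^ 0 / ((1 : ℕ) : ℂ) + w n ^ 1 / ((Nat.succ 0 * 1 : ℕ) : ℂ)
        + w n ^ 2 / ((Nat.succ 1 * (Nat.succ 0 * 1) : ℕ) : ℂ)) := by
      push_cast; ring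
    have h4 : ‖Complex.exp (w n) - 1 - w n - (w n) ^ 2 / 2‖ ≤ ‖w n‖ ^ 3 := by
      rw [e]
      refine h3.trans ?_
      have : 0 ≤ ‖w n‖ ^ 3 := by positivity
      push_cast
      nlinarith
    rw [norm_mul, norm_pow, Complex.norm_of_nonneg hqn.le]
    calc _ ≤ q n ^ 2 * ‖w n‖ ^ 3 := by gcongr
      _ = (q n * ‖w n‖) ^ 2 * ‖w n‖ := by ring
      _ = θ ^ 2 * ‖w n‖ := by
        rw [hwn, abs_of_pos hqn]
        congr 1
        rw [mul_div_cancel₀ _ hqn.ne', sq_abs]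
  have hexp : Tendsto (fun n => Complex.exp ((q n : ℂ) ^ 2 *
      (Complex.exp (w n) - 1 - w n - (w n) ^ 2 / 2) + -(θ : ℂ) ^ 2 / 2)) atTop
      (nhds (Complex.exp (-(θ : ℂ) ^ 2 / 2))) := by
    have := herr.add_const (-(θ : ℂ) ^ 2 / 2)
    rw [zero_add] at this
    exact (Complex.continuous_exp.tendsto _).comp this
  refine hexp.congr' ?_
  filter_upwards [hqt.eventually_gt_atTop 0] with n hqn
  unfold sv
  have hL : Real.log n = q n ^ 2 := (Real.sq_sqrt (Real.log_natCast_nonneg n)).symm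
  rw [← Complex.exp_add]
  congr 1
  have hq0 : (q n : ℂ) ≠ 0 := by exact_mod_cast hqn.ne'
  change _ = (Complex.exp (w n) - 1) * (Real.log n : ℝ) + -((θ * q n : ℝ) * Complex.I)
  rw [hL]
  have f1 : (q n : ℂ) ^ 2 * w n = (θ * q n : ℝ) * Complex.I := by
    simp only [hw]; push_cast; field_simp
  have f2 : (q n : ℂ) ^ 2 * (w n) ^ 2 = - (θ : ℂ) ^ 2 := by
    simp only [hw]; push_cast; rw [mul_pow, Complex.I_sq]; field_simp
  rw [← f1]
  push_cast
  linear_combination (-1 / 2 : ℂ) * f2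

lemma IsTotal.charfun_tendsto (H : IsTotal h) (P : ℕ → ℂ → ℂ)
    (hP : ∀ x : ℂ, ‖x‖ = 1 → IsTwist h x (fun n => P n x))
    (hc : ∀ n, ContinuousAt (P n) 1) (h1 : ∀ n, P n 1 = h n) (θ : ℝ) :
    Tendsto (fun n : ℕ =>
      P n (Complex.exp ((θ / Real.sqrt (Real.log n) : ℝ) * Complex.I)) / h n
      * Complex.exp (-((θ * Real.sqrt (Real.log n) : ℝ) * Complex.I))) atTop
    (nhds (Complex.exp (-(θ : ℂ) ^ 2 / 2))) := by
  set x : ℕ → ℂ := fun n => Complex.exp ((θ / Real.sqrt (Real.log n) : ℝ) * Complex.I) with hx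
  have hxn : ∀ n, ‖x n‖ = 1 := fun n => Complex.norm_exp_ofReal_mul_I _
  have hx1 : Tendsto x atTop (nhds 1) := by
    have h3 : Tendsto (fun n : ℕ => θ / Real.sqrt (Real.log n)) atTop (nhds 0) :=
      tendsto_sqrt_log.const_div_atTop θ
    have h4 : Continuous (fun y : ℝ => Complex.exp ((y : ℂ) * Complex.I)) := by fun_prop
    have h5 := (h4.tendsto 0).comp h3
    simp only [Complex.ofReal_zero, zero_mul, Complex.exp_zero] at h5
    exact h5
  have d := H.diff_tendsto P hP hc h1 x hxn hx1
  have d2 : Tendsto (fun n => (P n (x n) / h n - sv (x n) n) *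
      Complex.exp (-((θ * Real.sqrt (Real.log n) : ℝ) * Complex.I))) atTop (nhds 0) := by
    rw [tendsto_zero_iff_norm_tendsto_zero] at d ⊢
    refine d.congr fun n => ?_
    rw [norm_mul, ← neg_mul, ← Complex.ofReal_neg, Complex.norm_exp_ofReal_mul_I, mul_one]
  have := d2.add (sv_tendsto θ)
  rw [zero_add] at this
  refine this.congr fun n => ?_
  simp only [hx]
  ring

end CubicMaps

namespace CubicMaps
variable {h N : ℕ → ℝ}

/-- First moments. -/
structure IsMean (h N : ℕ → ℝ) : Prop where
  zero : N 0 = 4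
  one : N 1 = 65
  step : ∀ n, N (n + 2) = cA n * N n + cB n * (h (n + 1) + N (n + 1) +
    ∑ p ∈ antidiagonal n, (N p.1 * h p.2 + h p.1 * N p.2))

lemma IsMean.nonneg (H : IsTotal h) (M : IsMean h N) (n : ℕ) : 0 ≤ N n := by
  induction n using two_step with
  | h0 => rw [M.zero]; norm_num
  | h1 => rw [M.one]; norm_num
  | hs n ih =>
    rw [M.step]
    have h2 : 0 ≤ ∑ p ∈ antidiagonal n, (N p.1 * h p.2 + h p.1 * N p.2) := by
      apply sum_nonneg
      intro p hp
      have := mem_antidiagonal.1 hp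
      have a := mul_nonneg (ih p.1 (by omega)) (H.pos p.2).le
      have b := mul_nonneg (H.pos p.1).le (ih p.2 (by omega))
      linarith
    have a := mul_nonneg (cA_pos n).le (ih n (by omega))
    have b := ih (n + 1) le_rfl
    have c := H.pos (n + 1)
    have := cB_pos n
    positivity

lemma IsMean.conv_le (H : IsTotal h) {F : ℝ} {n : ℕ} (hF : ∀ k ≤ n, N k / h k ≤ F) :
    cB n * (∑ p ∈ antidiagonal n, (N p.1 * h p.2 + h p.1 * N p.2)) / h (n + 2)
      ≤ wc h n * (2 * F) := by
  have hp := H.pos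
  unfold wc
  rw [div_mul_eq_mul_div, mul_assoc, sum_mul]
  have := hp (n + 2)
  have := cB_pos n
  gcongr with p hpm
  have h1 := mem_antidiagonal.1 hpm
  have a := hF p.1 (by omega)
  have b := hF p.2 (by omega)
  rw [div_le_iff₀ (hp _)] at a b
  have a' := mul_le_mul_of_nonneg_right a (hp p.2).le
  have b' := mul_le_mul_of_nonneg_left b (hp p.1).le
  linarith

lemma IsMean.ratio_step (H : IsTotal h) (M : IsMean h N) (n : ℕ) :
    N (n + 2) / h (n + 2) = wa h n * (N n / h n) + wb h n * (1 + N (n + 1) / h (n + 1))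
      + cB n * (∑ p ∈ antidiagonal n, (N p.1 * h p.2 + h p.1 * N p.2)) / h (n + 2) := by
  have a1 := (H.pos n).ne'
  have a2 := (H.pos (n + 1)).ne'
  have a3 := (H.pos (n + 2)).ne'
  rw [M.step]
  unfold wa wb
  field_simp
  ring

lemma IsMean.crude (H : IsTotal h) (M : IsMean h N) :
    ∃ K : ℝ, 0 < K ∧ ∀ n : ℕ, N n / h n ≤ K * Real.sqrt (n + 1) := by
  obtain ⟨C, hC, hw⟩ := H.wb_close
  have hwb : ∀ n : ℕ, wb h n ≤ (C + 2) / (n + 2) := by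
    intro n
    have h1 := (abs_le.1 (hw n)).2
    have hn : (0 : ℝ) ≤ n := by positivity
    have h2 : C / ((n : ℝ) + 2) ^ 2 ≤ C / (n + 2) := by gcongr; nlinarith
    rw [add_div]; linarith
  set K := (2 * (C + 2) + 3) * Real.exp 240 with hK
  have hKp : 0 < K := by positivity
  set F : ℕ → ℝ := fun n => K * Real.exp (-240 / ((n : ℝ) + 1)) * Real.sqrt (n + 1) with hF
  have hKe : ∀ n : ℕ, 2 * (C + 2) + 3 ≤ K * Real.exp (-240 / ((n : ℝ) + 1)) := by
    intro n
    rw [hK, mul_assoc, ← Real.exp_add]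
    have : 1 ≤ Real.exp (240 + -240 / ((n : ℝ) + 1)) := by
      apply Real.one_le_exp
      have : 240 / ((n : ℝ) + 1) ≤ 240 := div_le_self (by norm_num) (by linarith [(Nat.cast_nonneg n : (0:ℝ) ≤ n)])
      rw [neg_div]; linarith
    nlinarith
  have hmono : ∀ m n : ℕ, m ≤ n → F m ≤ F n := by
    intro m n hmn
    have : (m : ℝ) ≤ n := by exact_mod_cast hmn
    simp only [hF]
    gcongr ?_ * Real.exp ?_ * Real.sqrt ?_
    · rw [neg_div, neg_div, neg_le_neg_iff]; gcongr
    · linarith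
  have hF1 : ∀ n, 2 * (C + 2) + 3 ≤ F n := by
    intro n
    have h1 := hKe n
    have h2 : 1 ≤ Real.sqrt ((n : ℝ) + 1) := by
      rw [Real.one_le_sqrt]; linarith [(Nat.cast_nonneg n : (0:ℝ) ≤ n)]
    simp only [hF]
    nlinarith
  have main : ∀ n, N n / h n ≤ F n := by
    intro n
    induction n using two_step with
    | h0 => rw [M.zero, H.zero]; have := hF1 0; linarith
    | h1 => rw [M.one, H.one]; have := hF1 1; linarith
    | hs n ih =>
      have hn : (0 : ℝ) ≤ n := by positivity
      have ih' : ∀ k ≤ n + 1, N k / h k ≤ F (n + 1) := fun k hk => (ih k hk).trans (hmono _ _ hk)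
      rw [M.ratio_step H]
      have c := IsMean.conv_le H (N := N) (n := n) (F := F (n + 1)) fun k hk => ih' k (by omega)
      have i0 := mul_le_mul_of_nonneg_left (ih' n (by omega)) (H.wa_nonneg n)
      have i1 := mul_le_mul_of_nonneg_left (ih' (n + 1) le_rfl) (H.wb_nonneg n)
      have ws := H.w_sum n
      have s1 : wa h n * (N n / h n) + wb h n * (1 + N (n + 1) / h (n + 1))
        + cB n * (∑ p ∈ antidiagonal n, (N p.1 * h p.2 + h p.1 * N p.2)) / h (n + 2)
        ≤ (1 + wc h n) * F (n + 1) + wb h n := by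
        have : wa h n = 1 - wb h n - wc h n := by linarith
        rw [this] at i0 ⊢
        nlinarith
      refine s1.trans ?_
      have wcl : wc h n ≤ 240 / (((n : ℝ) + 2) * (n + 3)) := by
        refine (H.wc_le n).trans ?_
        rw [div_mul_eq_mul_div, div_le_div_iff₀ (by positivity) (by positivity)]
        nlinarith
      have e1 : (1 + wc h n) * Real.exp (-240 / ((n : ℝ) + 2)) ≤ Real.exp (-240 / ((n : ℝ) + 3)) := by
        calc _ ≤ Real.exp (240 / (((n : ℝ) + 2) * (n + 3))) * Real.exp (-240 / ((n : ℝ) + 2)) := by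
              gcongr
              have := Real.add_one_le_exp (240 / (((n : ℝ) + 2) * (n + 3)))
              linarith
          _ = _ := by
              rw [← Real.exp_add]; congr 1; field_simp; ring
      have cast1 : ((n + 1 : ℕ) : ℝ) + 1 = n + 2 := by push_cast; ring
      have cast2 : ((n + 2 : ℕ) : ℝ) + 1 = n + 3 := by push_cast; ring
      have k2 := hKe (n + 2)
      simp only [hF]
      rw [cast1, cast2]
      rw [cast2] at k2
      set X := K * Real.exp (-240 / ((n : ℝ) + 3)) with hX
      have s2 : (1 + wc h n) * (K * Real.exp (-240 / ((n : ℝ) + 2)) * Real.sqrt (n + 2)) ≤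
          X * Real.sqrt (n + 2) := by
        calc _ = K * ((1 + wc h n) * Real.exp (-240 / ((n : ℝ) + 2))) * Real.sqrt (n + 2) := by ring
          _ ≤ _ := by rw [hX]; gcongr
      set a := Real.sqrt ((n : ℝ) + 2) with ha
      set b := Real.sqrt ((n : ℝ) + 3) with hb
      have ha2 : a ^ 2 = n + 2 := Real.sq_sqrt (by positivity)
      have hb2 : b ^ 2 = n + 3 := Real.sq_sqrt (by positivity)
      have hap : 0 ≤ a := Real.sqrt_nonneg _
      have hbp : 0 < b := Real.sqrt_pos.2 (by positivity)
      have hab : a ≤ b := Real.sqrt_le_sqrt (by linarith)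
      have hb3 : b ≤ n + 2 := by
        rw [hb, Real.sqrt_le_left (by positivity)]; nlinarith
      have s3 : (C + 2) / ((n : ℝ) + 2) ≤ X * (b - a) := by
        have h1 : 1 / (2 * b) ≤ b - a := by
          rw [div_le_iff₀ (by positivity)]; nlinarith
        have h2 : (C + 2) / ((n : ℝ) + 2) ≤ (C + 2) / b := by gcongr
        have h3 : (C + 2) / b = 2 * (C + 2) * (1 / (2 * b)) := by field_simp
        have h4 : 2 * (C + 2) * (1 / (2 * b)) ≤ X * (b - a) := by
          have : 0 ≤ 1 / (2 * b) := by positivity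
          apply mul_le_mul (by linarith) h1 this (by linarith)
        linarith
      have := hwb n
      linarith
  refine ⟨K, hKp, fun n => (main n).trans ?_⟩
  simp only [hF]
  gcongr
  have : Real.exp (-240 / ((n : ℝ) + 1)) ≤ 1 := by
    rw [Real.exp_le_one_iff, neg_div]
    have : (0 : ℝ) ≤ 240 / ((n : ℝ) + 1) := by positivity
    linarith
  nlinarith

lemma log_le_two_sqrt {n : ℕ} (hn : 1 ≤ n) : Real.log n ≤ 2 * Real.sqrt n := by
  have hp : (0 : ℝ) < n := by exact_mod_cast hn
  have h1 := Real.log_le_sub_one_of_pos (Real.sqrt_pos.2 hp)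
  rw [Real.log_sqrt hp.le] at h1
  linarith

lemma IsMean.bounded (H : IsTotal h) (M : IsMean h N) :
    ∃ B : ℝ, ∀ n : ℕ, 1 ≤ n → |N n / h n - Real.log n| ≤ B := by
  obtain ⟨K, hK, hmu⟩ := M.crude H
  obtain ⟨C, hC, hw⟩ := H.w_bounds
  set c := 2 * C * K * 2 + 4 + 2 * C + C + C with hc
  have hcp : 0 < c := by positivity
  set e : ℕ → ℝ := fun n => c * (Real.sqrt n / (n : ℝ) ^ 2) with he
  have he0 : ∀ n, 0 ≤ e n := fun n => by simp only [he]; positivity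
  have hsum : Summable e := by
    have h1 : Summable (fun n : ℕ => 1 / (n : ℝ) ^ (3 / 2 : ℝ)) :=
      Real.summable_one_div_nat_rpow.2 (by norm_num)
    refine (h1.congr fun n => ?_).mul_left c
    rcases Nat.eq_zero_or_pos n with rfl | hn
    · norm_num
    · have hp : (0 : ℝ) < n := by exact_mod_cast hn
      rw [Real.sqrt_eq_rpow, ← Real.rpow_natCast, ← Real.rpow_sub hp, one_div, ← Real.rpow_neg hp.le]
      norm_num
  have main := max_principle (d := fun n => |N n / h n - Real.log n|) (a := wa h) (b := wb h)
    (e := e) (S := fun n => ∑ j ∈ range (n - 1), e j) (N := 1)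
    (D := |N 1 / h 1 - Real.log (1 : ℕ)| + |N 2 / h 2 - Real.log (2 : ℕ)|)
    H.wa_nonneg H.wb_nonneg (fun n => by have := H.w_sum n; have := H.wc_nonneg n; linarith)
    ?_ (by positivity) (le_add_of_nonneg_right (abs_nonneg _))
    (le_add_of_nonneg_left (abs_nonneg _)) ?_ ?_ ?_
  · refine ⟨_, fun n hn => (main n hn).trans (add_le_add_right
      (hsum.sum_le_tsum _ fun i _ => he0 i) _)⟩
  · intro n hn
    have hn' : (1 : ℝ) ≤ n := by exact_mod_cast hn
    obtain ⟨w1, w2, w3⟩ := hw n hn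
    obtain ⟨l1, l2, l3⟩ := log_diff2 hn
    obtain ⟨m1, m2⟩ := log_diff1 hn
    have ll := log_le_two_sqrt hn
    have ln := Real.log_natCast_nonneg n
    have wc0 := H.wc_nonneg n
    have wb0 := H.wb_nonneg n
    have wa0 := H.wa_nonneg n
    have ws := H.w_sum n
    have hs1 : 1 ≤ Real.sqrt n := by rw [Real.one_le_sqrt]; exact hn'
    set R := cB n * (∑ p ∈ antidiagonal n, (N p.1 * h p.2 + h p.1 * N p.2)) / h (n + 2) with hR
    have hR0 : 0 ≤ R := by
      rw [hR]
      refine div_nonneg (mul_nonneg (cB_pos n).le (sum_nonneg fun p _ => ?_)) (H.pos _).le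
      exact add_nonneg (mul_nonneg (M.nonneg H _) (H.pos _).le)
        (mul_nonneg (H.pos _).le (M.nonneg H _))
    have hR1 : R ≤ wc h n * (2 * (K * Real.sqrt (n + 1))) := by
      apply IsMean.conv_le H
      intro k hk
      refine (hmu k).trans ?_
      gcongr
    have hsq : Real.sqrt ((n : ℝ) + 1) ≤ 2 * Real.sqrt n := by
      rw [Real.sqrt_le_left (by positivity), mul_pow, Real.sq_sqrt (by positivity)]
      linarith
    set s := Real.sqrt n with hs
    set i := s / (n : ℝ) ^ 2 with hi
    have hi1 : 1 / (n : ℝ) ^ 2 ≤ i := by rw [hi]; gcongr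
    have hR2 : R ≤ 2 * C * K * 2 * i := by
      refine hR1.trans ?_
      calc _ ≤ C / (n : ℝ) ^ 2 * (2 * (K * (2 * s))) := by gcongr
        _ = _ := by rw [hi]; ring
    have q1 : wc h n * Real.log n ≤ 2 * C * i := by
      calc _ ≤ C / (n : ℝ) ^ 2 * (2 * s) := by gcongr
        _ = _ := by rw [hi]; ring
    have q2 : 4 / (n : ℝ) ^ 2 ≤ 4 * i := by
      calc _ = 4 * (1 / (n : ℝ) ^ 2) := by ring
        _ ≤ _ := by gcongr
    have q3 : C / (n : ℝ) ^ 2 ≤ C * i := by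
      calc _ = C * (1 / (n : ℝ) ^ 2) := by ring
        _ ≤ _ := by gcongr
    have q4 : wb h n * (Real.log (n + 1 : ℕ) - Real.log n) ≤ C * i := by
      calc _ ≤ C / n * (1 / (n : ℝ)) := by gcongr
        _ = C / (n : ℝ) ^ 2 := by ring
        _ ≤ _ := q3
    have q5 : 0 ≤ wb h n * (Real.log (n + 1 : ℕ) - Real.log n) := mul_nonneg wb0 m1
    have q6 : 0 ≤ wc h n * Real.log n := mul_nonneg wc0 ln
    have q7 := abs_le.1 w2
    have hi0 : 0 ≤ i := by positivity
    have hCi : 0 ≤ C * i := by positivity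
    have hKi : 0 ≤ 2 * C * K * 2 * i := by positivity
    have id1 : N (n + 2) / h (n + 2) - Real.log (n + 2 : ℕ) =
        wa h n * (N n / h n - Real.log n) + wb h n * (N (n + 1) / h (n + 1) - Real.log (n + 1 : ℕ))
        + (R - (Real.log (n + 2 : ℕ) - Real.log n - 2 / ((n : ℝ) + 2)) - (2 / ((n : ℝ) + 2) - wb h n)
          - wc h n * Real.log n + wb h n * (Real.log (n + 1 : ℕ) - Real.log n)) := by
      rw [M.ratio_step H, ← hR]
      linear_combination (Real.log n) * ws
    have rem : |R - (Real.log (n + 2 : ℕ) - Real.log n - 2 / ((n : ℝ) + 2)) - (2 / ((n : ℝ) + 2) - wb h n)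
          - wc h n * Real.log n + wb h n * (Real.log (n + 1 : ℕ) - Real.log n)| ≤ e n := by
      have : e n = 2 * C * K * 2 * i + 4 * i + 2 * C * i + C * i + C * i := by
        simp only [he, hc]; ring
      rw [this, abs_le]
      constructor <;> linarith [q7.1, q7.2]
    rw [id1]
    refine (abs_add_le _ _).trans (add_le_add ((abs_add_le _ _).trans (add_le_add ?_ ?_)) rem)
    · rw [abs_mul, abs_of_nonneg wa0]
    · rw [abs_mul, abs_of_nonneg wb0]
  · intro n _
    exact sum_nonneg fun j _ => he0 j
  · intro n hn
    obtain ⟨m, rfl⟩ : ∃ m, n = m + 1 := ⟨n - 1, by omega⟩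
    simp only [Nat.add_sub_cancel]
    rw [sum_range_succ]
    linarith [he0 m]
  · intro n hn
    obtain ⟨m, rfl⟩ : ∃ m, n = m + 1 := ⟨n - 1, by omega⟩
    simp only [Nat.add_sub_cancel]
    exact (sum_range_succ e (m + 1)).ge

lemma IsMean.tendsto (H : IsTotal h) (M : IsMean h N) :
    Tendsto (fun n : ℕ => N n / h n / Real.log n) atTop (nhds 1) := by
  obtain ⟨B, hB⟩ := M.bounded H
  have hlog : Tendsto (fun n : ℕ => Real.log n) atTop atTop :=
    Real.tendsto_log_atTop.comp tendsto_natCast_atTop_atTop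
  rw [tendsto_iff_norm_sub_tendsto_zero]
  have hb : Tendsto (fun n : ℕ => B / Real.log n) atTop (nhds 0) := hlog.const_div_atTop B
  refine squeeze_zero' (Eventually.of_forall fun n => norm_nonneg _) ?_ hb
  filter_upwards [eventually_ge_atTop 1, hlog.eventually_gt_atTop 0] with n hn hl
  have : N n / h n / Real.log n - 1 = (N n / h n - Real.log n) / Real.log n := by
    rw [sub_div, div_self hl.ne']
  rw [this, Real.norm_eq_abs, abs_div, abs_of_pos hl]
  gcongr
  exact hB n hn

end CubicMaps

namespace CubicMaps

/-- The Goulden–Jackson data. -/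
structure IsGJ (H : ℤ → ℤ → ℚ) : Prop where
  neg_one : ∀ g : ℤ, H (-1) g = if g = 0 then 1/2 else 0
  zero : ∀ g : ℤ, H 0 g = if g = 0 then 2 else 0
  neg : ∀ n g : ℤ, g < 0 → H n g = 0
  step : ∀ n g : ℤ, 1 ≤ n → 0 ≤ g →
      H n g = (4*n*(3*n+2)*(3*n-2)/(n+1)) * H (n-2) (g-1)
        + (4*(3*n+2)/(n+1)) *
          ∑ k ∈ Finset.Icc (-1 : ℤ) (n-1), ∑ i ∈ Finset.Icc (0 : ℤ) g,
            H k i * H (n-2-k) (g-i)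

variable {H : ℤ → ℤ → ℚ}

/-- Induction over integers starting at `-1`. -/
lemma int_ind {p : ℤ → Prop} (h1 : p (-1)) (h0 : p 0)
    (hs : ∀ n : ℤ, 1 ≤ n → (∀ k, -1 ≤ k → k < n → p k) → p n) (n : ℤ) (hn : -1 ≤ n) : p n := by
  have key : ∀ m : ℕ, ∀ n : ℤ, -1 ≤ n → n < m → p n := by
    intro m
    induction m with
    | zero =>
      intro n a b
      have : n = -1 := by push_cast at b; omega
      rw [this]; exact h1
    | succ m ih =>
      intro n a b
      push_cast at b
      by_cases c : 1 ≤ n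
      · exact hs n c fun k k1 k2 => ih k k1 (by omega)
      · have : n = -1 ∨ n = 0 := by omega
        rcases this with rfl | rfl
        · exact h1
        · exact h0
  exact key (n + 1).toNat n hn (by omega)

lemma IsGJ.nonneg (G : IsGJ H) (n : ℤ) (hn : -1 ≤ n) : ∀ g, 0 ≤ H n g := by
  refine int_ind (p := fun n => ∀ g, 0 ≤ H n g) ?_ ?_ ?_ n hn
  · intro g; rw [G.neg_one]; split_ifs <;> norm_num
  · intro g; rw [G.zero]; split_ifs <;> norm_num
  · intro n hn ih g
    by_cases hg : g < 0
    · rw [G.neg n g hg]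
    · rw [G.step n g hn (by omega)]
      have hn' : (1 : ℚ) ≤ n := by exact_mod_cast hn
      have a := ih (n - 2) (by omega) (by omega) (g - 1)
      have b : 0 ≤ ∑ k ∈ Finset.Icc (-1 : ℤ) (n-1), ∑ i ∈ Finset.Icc (0 : ℤ) g,
            H k i * H (n-2-k) (g-i) := by
        refine sum_nonneg fun k hk => sum_nonneg fun i _ => ?_
        rw [Finset.mem_Icc] at hk
        exact mul_nonneg (ih k (by omega) (by omega) i) (ih (n - 2 - k) (by omega) (by omega) _)
      have c1 : (0 : ℚ) ≤ 3 * n - 2 := by linarith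
      positivity

lemma IsGJ.vanish (G : IsGJ H) (n : ℤ) (hn : -1 ≤ n) : ∀ g, n + 2 < 2 * g → H n g = 0 := by
  refine int_ind (p := fun n => ∀ g, n + 2 < 2 * g → H n g = 0) ?_ ?_ ?_ n hn
  · intro g hg; rw [G.neg_one, if_neg (by omega)]
  · intro g hg; rw [G.zero, if_neg (by omega)]
  · intro n hn ih g hg
    rw [G.step n g hn (by omega), ih (n - 2) (by omega) (by omega) (g - 1) (by omega)]
    rw [mul_zero, zero_add, sum_eq_zero, mul_zero]
    intro k hk
    rw [Finset.mem_Icc] at hk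
    refine sum_eq_zero fun i hi => ?_
    by_cases c : k + 2 < 2 * i
    · rw [ih k (by omega) (by omega) i c, zero_mul]
    · rw [ih (n - 2 - k) (by omega) (by omega) (g - i) (by omega), mul_zero]

lemma IsGJ.vanish' (G : IsGJ H) (n : ℕ) (g : ℤ) (hg : n < g) : H n g = 0 := by
  rcases Nat.eq_zero_or_pos n with rfl | hn
  · have := G.zero g
    rw [if_neg (by push_cast at hg; omega)] at this
    exact_mod_cast this
  · exact G.vanish n (by omega) g (by omega)

lemma sum_Icc_int {M : Type*} [AddCommMonoid M] (f : ℤ → M) (n : ℕ) :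
    ∑ i ∈ Finset.Icc (0 : ℤ) n, f i = ∑ i ∈ range (n + 1), f i := by
  refine sum_nbij' (fun i => i.toNat) (fun i => (i : ℤ)) ?_ ?_ ?_ ?_ ?_
  · intro i hi; rw [Finset.mem_Icc] at hi; rw [Finset.mem_range]; omega
  · intro i hi; rw [Finset.mem_range] at hi; rw [Finset.mem_Icc]; omega
  · intro i hi; rw [Finset.mem_Icc] at hi; simp; omega
  · intro i _; simp
  · intro i hi; rw [Finset.mem_Icc] at hi; congr 1; simp; omega

lemma sum_Icc_int' (f : ℤ → ℚ) (n : ℕ) :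
    ∑ i ∈ Finset.Icc (-1 : ℤ) (n + 1), f i = f (-1) + f (n + 1) + ∑ i ∈ range (n + 1), f i := by
  have e : Finset.Icc (-1 : ℤ) (n + 1) = insert (-1) (insert ((n : ℤ) + 1) (Finset.Icc 0 (n : ℤ))) := by
    ext i; simp only [Finset.mem_insert, Finset.mem_Icc]; omega
  rw [e, sum_insert, sum_insert, sum_Icc_int, add_assoc]
  · simp
  · simp only [Finset.mem_insert, Finset.mem_Icc]; omega

/-- Genus convolution. -/
def gconv (H : ℤ → ℤ → ℚ) (k l : ℤ) (g : ℕ) : ℚ :=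
  ∑ p ∈ antidiagonal g, H k p.1 * H l p.2

lemma gconv_eq (k l : ℤ) (g : ℕ) :
    ∑ i ∈ Finset.Icc (0 : ℤ) g, H k i * H l (g - i) = gconv H k l g := by
  rw [sum_Icc_int (fun i => H k i * H l (g - i)), gconv,
    Nat.sum_antidiagonal_eq_sum_range_succ (fun a b => H k a * H l b)]
  refine sum_congr rfl fun i hi => ?_
  rw [Finset.mem_range] at hi
  rw [Nat.cast_sub (by omega)]

lemma IsGJ.gconv_left (G : IsGJ H) (l : ℤ) (g : ℕ) : gconv H (-1) l g = 1 / 2 * H l g := by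
  unfold gconv
  rw [Nat.sum_antidiagonal_eq_sum_range_succ (fun a b => H (-1) a * H l b), sum_range_succ']
  simp [G.neg_one]
  exact sum_eq_zero fun i _ => if_neg (by omega)

lemma IsGJ.gconv_right (G : IsGJ H) (l : ℤ) (g : ℕ) : gconv H l (-1) g = 1 / 2 * H l g := by
  rw [← G.gconv_left, gconv, gconv, ← Nat.sum_antidiagonal_swap]
  exact sum_congr rfl fun p _ => mul_comm _ _

lemma IsGJ.step' (G : IsGJ H) (n g : ℕ) :
    H (n + 2 : ℕ) g = 4 * ((n : ℚ) + 2) * (3 * n + 8) * (3 * n + 4) / (n + 3) * H n (g - 1)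
      + 4 * (3 * (n : ℚ) + 8) / (n + 3) *
        (H (n + 1 : ℕ) g + ∑ p ∈ antidiagonal n, gconv H p.1 p.2 g) := by
  have h1 := G.step (n + 2 : ℕ) g (by omega) (by omega)
  have e : ∀ k : ℤ, ∑ i ∈ Finset.Icc (0 : ℤ) g, H k i * H (((n + 2 : ℕ) : ℤ) - 2 - k) (g - i) =
      gconv H k (n - k) g := by
    intro k
    rw [← gconv_eq]
    congr! 3
    push_cast; ring
  rw [sum_congr rfl fun k _ => e k] at h1
  rw [show (((n + 2 : ℕ) : ℤ) - 1) = n + 1 by push_cast; ring, sum_Icc_int' (fun k => gconv H k (n - k) g),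
    show (n : ℤ) - -1 = (n + 1 : ℕ) by push_cast; ring, G.gconv_left,
    show (n : ℤ) - (n + 1) = -1 by ring, G.gconv_right,
    show ((n + 2 : ℕ) : ℤ) - 2 = n by push_cast; ring] at h1
  rw [h1, Nat.sum_antidiagonal_eq_sum_range_succ (fun a b => gconv H a b g)]
  have e2 : ∑ i ∈ range (n + 1), gconv H (i : ℤ) ((n : ℤ) - i) g =
      ∑ i ∈ range n.succ, gconv H (i : ℤ) ((n - i : ℕ) : ℤ) g := by
    refine sum_congr rfl fun i hi => ?_
    rw [Finset.mem_range] at hi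
    rw [Nat.cast_sub (by omega)]
  rw [e2]
  push_cast
  ring_nf

open Polynomial in
/-- Genus polynomial. -/
noncomputable def gp (H : ℤ → ℤ → ℚ) (n : ℕ) : ℝ[X] :=
  ∑ g ∈ range (n + 1), monomial g ((H n g : ℚ) : ℝ)

lemma IsGJ.gp_coeff (G : IsGJ H) (n g : ℕ) : (gp H n).coeff g = ((H n g : ℚ) : ℝ) := by
  unfold gp
  simp only [Polynomial.finsetSum_coeff, Polynomial.coeff_monomial, sum_ite_eq', Finset.mem_range]
  split_ifs with h
  · rfl
  · rw [G.vanish' n g (by omega)]; simp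

open Polynomial in
lemma IsGJ.gp_step (G : IsGJ H) (n : ℕ) :
    gp H (n + 2) = C (cA n) * (X * gp H n) + C (cB n) *
      (gp H (n + 1) + ∑ p ∈ antidiagonal n, gp H p.1 * gp H p.2) := by
  ext g
  have hX : (X * gp H n).coeff g = ((H n (g - 1) : ℚ) : ℝ) := by
    cases g with
    | zero => rw [Polynomial.coeff_X_mul_zero, G.neg _ _ (by simp)]; simp
    | succ g => rw [Polynomial.coeff_X_mul, G.gp_coeff]; simp
  rw [coeff_add, coeff_C_mul, coeff_C_mul, coeff_add, hX, finsetSum_coeff, G.gp_coeff, G.gp_coeff,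
    G.step']
  have e : ∀ p : ℕ × ℕ, (gp H p.1 * gp H p.2).coeff g = ((gconv H p.1 p.2 g : ℚ) : ℝ) := by
    intro p
    rw [coeff_mul, gconv]
    push_cast
    exact sum_congr rfl fun q _ => by rw [G.gp_coeff, G.gp_coeff]
  rw [sum_congr rfl fun p _ => e p]
  unfold cA cB
  push_cast
  rfl

lemma IsGJ.one_zero (G : IsGJ H) : H 1 0 = 20 := by
  have h1 := G.step 1 0 (by norm_num) (by norm_num)
  rw [show (1 : ℤ) - 1 = (0 : ℤ) by norm_num, show Finset.Icc (-1 : ℤ) 0 = {-1, 0} by decide,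
    sum_pair (by norm_num)] at h1
  simp [G.neg_one, G.zero] at h1
  rw [h1]; norm_num

lemma IsGJ.one_one (G : IsGJ H) : H 1 1 = 5 := by
  have h1 := G.step 1 1 (by norm_num) (by norm_num)
  rw [show (1 : ℤ) - 1 = (0 : ℤ) by norm_num, show Finset.Icc (-1 : ℤ) 0 = {-1, 0} by decide,
    sum_pair (by norm_num), show Finset.Icc (0 : ℤ) 1 = {0, 1} by decide,
    sum_pair (by norm_num), sum_pair (by norm_num)] at h1
  simp [G.neg_one, G.zero] at h1
  rw [h1]; norm_num

/-- Row totals. -/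
noncomputable def tot (H : ℤ → ℤ → ℚ) (n : ℕ) : ℝ := (gp H n).eval 1

lemma tot_eq (n : ℕ) : tot H n = ∑ g ∈ range (n + 1), ((H n g : ℚ) : ℝ) := by
  simp [tot, gp, Polynomial.eval_finsetSum]

/-- First moments of the face number. -/
noncomputable def mom (H : ℤ → ℤ → ℚ) (n : ℕ) : ℝ :=
  (n + 2) * (gp H n).eval 1 - 2 * (gp H n).derivative.eval 1

lemma mom_eq (n : ℕ) : mom H n = ∑ g ∈ range (n + 1), ((n : ℝ) + 2 - 2 * g) * ((H n g : ℚ) : ℝ) := by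
  simp only [mom, gp, Polynomial.eval_finsetSum, Polynomial.derivative_sum,
    Polynomial.derivative_monomial, Polynomial.eval_monomial, one_pow, mul_one]
  rw [mul_sum, mul_sum, ← sum_sub_distrib]
  exact sum_congr rfl fun g _ => by ring

lemma IsGJ.isTotal (G : IsGJ H) : IsTotal (tot H) where
  zero := by rw [tot_eq]; simp [G.zero]
  one := by rw [tot_eq]; simp [sum_range_succ, G.one_zero, G.one_one]; norm_num
  step n := by
    unfold tot
    rw [G.gp_step]
    simp [Polynomial.eval_finsetSum]

lemma IsGJ.isMean (G : IsGJ H) : IsMean (tot H) (mom H) where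
  zero := by rw [mom_eq]; simp [G.zero]; norm_num
  one := by rw [mom_eq]; simp [sum_range_succ, G.one_zero, G.one_one]; norm_num
  step n := by
    have e : ∑ p ∈ antidiagonal n, (mom H p.1 * tot H p.2 + tot H p.1 * mom H p.2) =
        (n + 4) * ∑ p ∈ antidiagonal n, (gp H p.1).eval 1 * (gp H p.2).eval 1
        - 2 * ∑ p ∈ antidiagonal n, ((gp H p.1).derivative.eval 1 * (gp H p.2).eval 1
          + (gp H p.1).eval 1 * (gp H p.2).derivative.eval 1) := by
      rw [mul_sum, mul_sum, ← sum_sub_distrib]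
      refine sum_congr rfl fun p hp => ?_
      have : (n : ℝ) = p.1 + p.2 := by rw [← mem_antidiagonal.1 hp]; push_cast; ring
      unfold mom tot
      rw [this]; ring
    rw [e]
    unfold mom tot
    rw [G.gp_step]
    simp [Polynomial.eval_finsetSum, Polynomial.derivative_mul]
    ring

/-- Face generating polynomial. -/
noncomputable def fp (H : ℤ → ℤ → ℚ) (n : ℕ) (x : ℂ) : ℂ :=
  x ^ (n + 2) * Polynomial.aeval ((x⁻¹) ^ 2) (gp H n)

lemma fp_eq (n : ℕ) (x : ℂ) : fp H n x =
    ∑ g ∈ range (n + 1), (((H n g : ℚ) : ℝ) : ℂ) * (x ^ (n + 2) * ((x⁻¹) ^ 2) ^ g) := by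
  simp only [fp, gp, map_sum, Polynomial.aeval_monomial, mul_sum]
  exact sum_congr rfl fun g _ => by simp; ring

lemma IsGJ.isTwist (G : IsGJ H) (x : ℂ) (hx : ‖x‖ = 1) : IsTwist (tot H) x (fun n => fp H n x) where
  bound n := by
    rw [fp_eq, tot_eq]
    refine (norm_sum_le _ _).trans (sum_le_sum fun g _ => ?_)
    have : (0 : ℝ) ≤ ((H n g : ℚ) : ℝ) := by exact_mod_cast G.nonneg n (by omega) g
    rw [norm_mul, Complex.norm_of_nonneg this]
    simp [hx]
  step n := by
    have hx0 : x ≠ 0 := by rintro rfl; simp at hx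
    unfold fp
    rw [G.gp_step]
    simp only [map_add, map_mul, map_sum, Polynomial.aeval_C, Polynomial.aeval_X]
    have e : ∑ p ∈ antidiagonal n, x ^ (p.1 + 2) * Polynomial.aeval ((x⁻¹) ^ 2) (gp H p.1) *
        (x ^ (p.2 + 2) * Polynomial.aeval ((x⁻¹) ^ 2) (gp H p.2)) = x ^ (n + 4) *
        ∑ p ∈ antidiagonal n, Polynomial.aeval ((x⁻¹) ^ 2) (gp H p.1) *
          Polynomial.aeval ((x⁻¹) ^ 2) (gp H p.2) := by
      rw [mul_sum]
      refine sum_congr rfl fun p hp => ?_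
      rw [← mem_antidiagonal.1 hp]
      ring
    rw [e]
    have e2 : x ^ (n + 2 + 2) * (x⁻¹) ^ 2 = x ^ (n + 2) := by
      field_simp
      ring
    simp only [Complex.coe_algebraMap]
    linear_combination (cA n : ℂ) * Polynomial.aeval ((x⁻¹) ^ 2) (gp H n) * e2

lemma fp_one (n : ℕ) : fp H n 1 = tot H n := by
  rw [fp_eq, tot_eq]; simp

lemma fp_cont (n : ℕ) : ContinuousAt (fp H n) 1 := by
  unfold fp
  have h1 : ContinuousAt (fun x : ℂ => (x⁻¹) ^ 2) 1 := (continuousAt_inv₀ one_ne_zero).pow 2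
  have h2 : ContinuousAt (fun x : ℂ => Polynomial.aeval ((x⁻¹) ^ 2) (gp H n)) 1 :=
    ContinuousAt.comp (g := fun y : ℂ => Polynomial.aeval y (gp H n))
      (Polynomial.continuous_aeval (gp H n)).continuousAt h1
  exact (continuousAt_id.pow _).mul h2

end CubicMaps

namespace CubicMaps

variable {H : ℤ → ℤ → ℚ}

/-- Probability that the genus equals `g`. -/
noncomputable def pr (H : ℤ → ℤ → ℚ) (n g : ℕ) : ℝ := ((H n g : ℚ) : ℝ) / tot H n

/-- Normalized face count. -/
noncomputable def pt (n g : ℕ) : ℝ := ((n : ℝ) + 2 - 2 * g - Real.log n) / √(Real.log n)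

/-- Law of the normalized face count. -/
noncomputable def law (H : ℤ → ℤ → ℚ) (n : ℕ) : Measure ℝ :=
  ∑ g ∈ range (n + 1), ENNReal.ofReal (pr H n g) • Measure.dirac (pt n g)

lemma IsGJ.pr_nonneg (G : IsGJ H) (n g : ℕ) : 0 ≤ pr H n g := by
  have h1 : (0 : ℝ) ≤ ((H n g : ℚ) : ℝ) := by exact_mod_cast G.nonneg n (by omega) g
  exact div_nonneg h1 (G.isTotal.pos n).le

lemma IsGJ.pr_sum (G : IsGJ H) (n : ℕ) : ∑ g ∈ range (n + 1), pr H n g = 1 := by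
  unfold pr
  rw [← sum_div, ← tot_eq, div_self (G.isTotal.pos n).ne']

lemma IsGJ.isProb (G : IsGJ H) (n : ℕ) : IsProbabilityMeasure (law H n) := by
  constructor
  simp only [law, Measure.coe_finsetSum, Finset.sum_apply, Measure.smul_apply, measure_univ,
    smul_eq_mul, mul_one]
  rw [← ENNReal.ofReal_sum_of_nonneg fun g _ => G.pr_nonneg n g, G.pr_sum, ENNReal.ofReal_one]

lemma IsGJ.law_Iic (G : IsGJ H) (n : ℕ) (t : ℝ) :
    (law H n (Set.Iic t)).toReal = ∑ g ∈ range (n + 1), if pt n g ≤ t then pr H n g else 0 := by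
  have e : law H n (Set.Iic t) =
      ENNReal.ofReal (∑ g ∈ range (n + 1), if pt n g ≤ t then pr H n g else 0) := by
    rw [ENNReal.ofReal_sum_of_nonneg]
    · simp only [law, Measure.coe_finsetSum, Finset.sum_apply, Measure.smul_apply, smul_eq_mul]
      refine sum_congr rfl fun g _ => ?_
      rw [Measure.dirac_apply' _ measurableSet_Iic]
      by_cases c : pt n g ≤ t <;> simp [Set.indicator, c]
    · intro g _
      split_ifs
      · exact G.pr_nonneg n g
      · exact le_rfl
  rw [e, ENNReal.toReal_ofReal]
  refine sum_nonneg fun g _ => ?_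
  split_ifs
  · exact G.pr_nonneg n g
  · exact le_rfl

lemma IsGJ.law_charFun (G : IsGJ H) (n : ℕ) (hn : 0 < Real.log n) (θ : ℝ) :
    charFun (law H n) θ = fp H n (Complex.exp ((θ / √(Real.log n) : ℝ) * Complex.I)) / tot H n
      * Complex.exp (-((θ * √(Real.log n) : ℝ) * Complex.I)) := by
  rw [charFun_apply_real, law, integral_finsetSum_measure, fp_eq, sum_div, sum_mul]
  · refine sum_congr rfl fun g _ => ?_
    rw [integral_smul_measure, integral_dirac, ENNReal.toReal_ofReal (G.pr_nonneg n g), pr,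
      ← Complex.exp_neg, ← Complex.exp_nat_mul, ← Complex.exp_nat_mul, ← Complex.exp_nat_mul,
      ← Complex.exp_add, Complex.real_smul, Complex.ofReal_div, mul_div_right_comm,
      mul_assoc (_ / _) (Complex.exp _) (Complex.exp _), ← Complex.exp_add]
    congr 2
    have hs : √(Real.log n) ≠ 0 := (Real.sqrt_pos.2 hn).ne'
    have e : θ * pt n g = (n + 2) * (θ / √(Real.log n)) - 2 * g * (θ / √(Real.log n))
        - θ * √(Real.log n) := by
      unfold pt
      field_simp
      rw [Real.sq_sqrt hn.le]

    rw [← Complex.ofReal_mul, e]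
    push_cast
    ring
  · intro g _
    exact (integrable_dirac (by simp)).smul_measure (by simp)

lemma tendsto_log_nat : Tendsto (fun n : ℕ => Real.log n) atTop atTop :=
  Real.tendsto_log_atTop.comp tendsto_natCast_atTop_atTop

lemma IsGJ.clt (G : IsGJ H) (t : ℝ) :
    Tendsto (fun n => (law H n (Set.Iic t)).toReal) atTop
      (nhds ((Real.sqrt (2 * Real.pi))⁻¹ * ∫ x in Set.Iic t, Real.exp (-x ^ 2 / 2))) := by
  let μ : ℕ → ProbabilityMeasure ℝ := fun n => ⟨law H n, G.isProb n⟩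
  let ν : ProbabilityMeasure ℝ := ⟨ProbabilityTheory.gaussianReal 0 1, inferInstance⟩
  have key : Tendsto μ atTop (nhds ν) := by
    refine ProbabilityMeasure.tendsto_of_tendsto_charFun fun θ => ?_
    have e : charFun (ν : Measure ℝ) θ = Complex.exp (-(θ : ℂ) ^ 2 / 2) := by
      change charFun (ProbabilityTheory.gaussianReal 0 1) θ = _
      rw [ProbabilityTheory.charFun_gaussianReal]
      congr 1
      push_cast
      simp
      ring
    rw [e]
    refine (G.isTotal.charfun_tendsto (fp H) (fun x hx => G.isTwist x hx) fp_cont fp_one θ).congr' ?_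
    filter_upwards [tendsto_log_nat.eventually_gt_atTop 0] with n hn
    exact (G.law_charFun n hn θ).symm
  have h2 := ProbabilityMeasure.tendsto_measure_of_null_frontier_of_tendsto' key
    (E := Set.Iic t) (by
      change ProbabilityTheory.gaussianReal 0 1 _ = 0
      rw [frontier_Iic]
      have := ProbabilityTheory.nullSingletonClass_gaussianReal (μ := 0) (v := 1) one_ne_zero
      exact measure_singleton t)
  have h3 := (ENNReal.tendsto_toReal (measure_ne_top (ν : Measure ℝ) (Set.Iic t))).comp h2
  have e : ((ν : Measure ℝ) (Set.Iic t)).toReal =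
      (Real.sqrt (2 * Real.pi))⁻¹ * ∫ x in Set.Iic t, Real.exp (-x ^ 2 / 2) := by
    change (ProbabilityTheory.gaussianReal 0 1 (Set.Iic t)).toReal = _
    rw [ProbabilityTheory.gaussianReal_apply_eq_integral 0 one_ne_zero, ENNReal.toReal_ofReal,
      ← integral_const_mul]
    · simp [ProbabilityTheory.gaussianPDFReal]
    · exact integral_nonneg fun x => ProbabilityTheory.gaussianPDFReal_nonneg _ _ _
  rw [e] at h3
  exact h3

lemma total_cast (n : ℕ) :
    ((∑ g ∈ Finset.Icc (0 : ℤ) (n : ℤ), H (n : ℤ) g / (3 * (n : ℚ) + 2) : ℚ) : ℝ)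
      = tot H n / (3 * (n : ℝ) + 2) := by
  rw [sum_Icc_int (fun g => H (n : ℤ) g / (3 * (n : ℚ) + 2)), tot_eq, sum_div]
  push_cast
  rfl

lemma mean_cast (n : ℕ) :
    ((∑ g ∈ Finset.Icc (0 : ℤ) (n : ℤ),
      ((n : ℚ) + 2 - 2 * (g : ℚ)) * (H (n : ℤ) g / (3 * (n : ℚ) + 2)) : ℚ) : ℝ)
      = mom H n / (3 * (n : ℝ) + 2) := by
  rw [sum_Icc_int (fun g => ((n : ℚ) + 2 - 2 * (g : ℚ)) * (H (n : ℤ) g / (3 * (n : ℚ) + 2))),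
    mom_eq, sum_div]
  push_cast
  exact sum_congr rfl fun g _ => by ring

lemma IsGJ.main_clt (G : IsGJ H) (t : ℝ) :
      Tendsto
        (fun n : ℕ =>
          (∑ g ∈ Finset.Icc (0 : ℤ) (n : ℤ),
              if ((n : ℝ) + 2 - 2 * (g : ℝ)) ≤ Real.log n + t * Real.sqrt (Real.log n)
              then ((H (n : ℤ) g / (3 * (n : ℚ) + 2) : ℚ) : ℝ) else 0) /
            ((∑ g ∈ Finset.Icc (0 : ℤ) (n : ℤ),
              H (n : ℤ) g / (3 * (n : ℚ) + 2) : ℚ) : ℝ))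
        atTop
        (nhds ((Real.sqrt (2 * Real.pi))⁻¹ * ∫ x in Set.Iic t, Real.exp (-x ^ 2 / 2))) := by
  refine (G.clt t).congr' ?_
  filter_upwards [tendsto_log_nat.eventually_gt_atTop 0] with n hn
  rw [G.law_Iic, total_cast, sum_Icc_int (fun g : ℤ =>
    if ((n : ℝ) + 2 - 2 * (g : ℝ)) ≤ Real.log n + t * Real.sqrt (Real.log n)
              then ((H (n : ℤ) g / (3 * (n : ℚ) + 2) : ℚ) : ℝ) else 0), sum_div]
  refine sum_congr rfl fun g _ => ?_
  have hc : pt n g ≤ t ↔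
      ((n : ℝ) + 2 - 2 * ((g : ℤ) : ℝ)) ≤ Real.log n + t * Real.sqrt (Real.log n) := by
    unfold pt
    rw [div_le_iff₀ (Real.sqrt_pos.2 hn), sub_le_iff_le_add, add_comm (Real.log n), Int.cast_natCast]
  have hp := (G.isTotal.pos n).ne'
  have h3 : (3 * (n : ℝ) + 2) ≠ 0 := by positivity
  by_cases c : pt n g ≤ t
  · rw [if_pos c, if_pos (hc.1 c), pr]
    push_cast
    field_simp
  · rw [if_neg c, if_neg (fun d => c (hc.2 d)), zero_div]

lemma IsGJ.main_mean (G : IsGJ H) :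
    Tendsto
      (fun n : ℕ =>
        (((∑ g ∈ Finset.Icc (0 : ℤ) (n : ℤ),
              ((n : ℚ) + 2 - 2 * (g : ℚ)) * (H (n : ℤ) g / (3 * (n : ℚ) + 2))) /
            (∑ g ∈ Finset.Icc (0 : ℤ) (n : ℤ),
              H (n : ℤ) g / (3 * (n : ℚ) + 2)) : ℚ) : ℝ) / Real.log n)
      atTop (nhds 1) := by
  refine (G.isMean.tendsto G.isTotal).congr fun n => ?_
  rw [Rat.cast_div, total_cast, mean_cast]
  have h3 : (3 * (n : ℝ) + 2) ≠ 0 := by positivity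
  rw [div_div_div_cancel_right₀ h3]

end CubicMaps

/-- **Asymptotic normality of the region (face-count) distribution of cubic
graphs**, with mean and variance both asymptotic to `ln n`: the number of faces
of a map counted by `C(n,g)` is `n + 2 - 2g`. -/
theorem region_distribution_asymptotically_normal
    (H : ℤ → ℤ → ℚ)
    (hH1 : ∀ g : ℤ, H (-1) g = if g = 0 then 1/2 else 0)
    (hH2 : ∀ g : ℤ, H 0 g = if g = 0 then 2 else 0)
    (hH3 : ∀ n g : ℤ, g < 0 → H n g = 0)
    (hHrec : ∀ n g : ℤ, 1 ≤ n → 0 ≤ g →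
      H n g = (4*n*(3*n+2)*(3*n-2)/(n+1)) * H (n-2) (g-1)
        + (4*(3*n+2)/(n+1)) *
          ∑ k ∈ Finset.Icc (-1 : ℤ) (n-1), ∑ i ∈ Finset.Icc (0 : ℤ) g,
            H k i * H (n-2-k) (g-i)) :
    (∀ t : ℝ,
      Tendsto
        (fun n : ℕ =>
          (∑ g ∈ Finset.Icc (0 : ℤ) (n : ℤ),
              if ((n : ℝ) + 2 - 2 * (g : ℝ)) ≤ Real.log n + t * Real.sqrt (Real.log n)
              then ((H (n : ℤ) g / (3 * (n : ℚ) + 2) : ℚ) : ℝ) else 0) /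
            ((∑ g ∈ Finset.Icc (0 : ℤ) (n : ℤ),
              H (n : ℤ) g / (3 * (n : ℚ) + 2) : ℚ) : ℝ))
        atTop
        (nhds ((Real.sqrt (2 * Real.pi))⁻¹ * ∫ x in Set.Iic t, Real.exp (-x ^ 2 / 2)))) ∧
    Tendsto
      (fun n : ℕ =>
        (((∑ g ∈ Finset.Icc (0 : ℤ) (n : ℤ),
              ((n : ℚ) + 2 - 2 * (g : ℚ)) * (H (n : ℤ) g / (3 * (n : ℚ) + 2))) /
            (∑ g ∈ Finset.Icc (0 : ℤ) (n : ℤ),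
              H (n : ℤ) g / (3 * (n : ℚ) + 2)) : ℚ) : ℝ) / Real.log n)
      atTop (nhds 1) := by
  have G : CubicMaps.IsGJ H := ⟨hH1, hH2, hH3, hHrec⟩
  exact ⟨fun t => G.main_clt t, G.main_mean⟩
end
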